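/- Let (Λ, ξ) be a decorated D-lattice of dimension N ≥ 4, v ∈ Λ a hyperelliptic vector, and η the induced decoration of v^⊥ ≅ Λ_{N-1}. If w ∈ v^⊥ is a hyperelliptic vector of Λ orthogonal to v (w² = -4, div_Λ(w) = 2, w* = ξ), then either (1) div_{v^⊥}(w) = 2 and w is a hyperelliptic vector of (v^⊥, η), or (2) div_{v^⊥}(w) = 4, {v,w}^⊥ ≅ II_{2,N-2}, and N ≡ 4 (mod 8). -/

import Mathlib

noncomputable section

open scoped BigOperators

/-- `x` has integer entries. -/
def IntVec {n : ℕ} (x : Fin n → ℚ) : Prop := ∀ i, ∃ a : ℤ, x i = (a : ℚ)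

/-- The lattice `D_n = {x ∈ ℤⁿ : Σ xᵢ ≡ 0 mod 2}` (viewed inside `ℚⁿ`),
equipped with the negative of the Euclidean form `negE`. -/
def DSet (n : ℕ) : Set (Fin n → ℚ) :=
  {x | IntVec x ∧ ∃ a : ℤ, (∑ i, x i) = 2 * (a : ℚ)}

/-- The negative of the standard Euclidean bilinear form. -/
def negE {n : ℕ} (x y : Fin n → ℚ) : ℚ := - ∑ i, x i * y i

/-- The vector `(1/2, …, 1/2)`. -/
def halfVec (n : ℕ) : Fin n → ℚ := fun _ => 1/2

/-- The lattice `Λ_N = U² ⊕ D_{N-2}` realized inside `ℚ^{N+2}`: integral vectors whose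
coordinates of index `≥ 4` have even sum.  The first four coordinates carry the two
hyperbolic planes. -/
def LamSet (N : ℕ) : Set (Fin (N + 2) → ℚ) :=
  {x | IntVec x ∧ ∃ a : ℤ, (∑ i : Fin (N + 2), if 4 ≤ (i : ℕ) then x i else 0) = 2 * (a : ℚ)}

/-- The bilinear form of `Λ_N = U² ⊕ D_{N-2}`. -/
def LamForm (N : ℕ) (x y : Fin (N + 2) → ℚ) : ℚ :=
  x 0 * y 1 + x 1 * y 0 + x 2 * y 3 + x 3 * y 2
    - ∑ i : Fin (N + 2), (if 4 ≤ (i : ℕ) then x i * y i else 0)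

/-- The (negative definite) `E₈` lattice inside `ℚ⁸`: vectors that are integral or
half-integral, with even coordinate sum; the form is `negE`. -/
def E8Set : Set (Fin 8 → ℚ) :=
  {x | (IntVec x ∨ IntVec (x - halfVec 8)) ∧ ∃ a : ℤ, (∑ i, x i) = 2 * (a : ℚ)}

/-- Ambient space for the even unimodular lattice `II_{2,2+8k} = U² ⊕ E₈^k`. -/
abbrev IIAmb (k : ℕ) := (Fin 4 → ℚ) × (Fin k → Fin 8 → ℚ)

/-- The form of `U²` on `ℚ⁴`. -/
def UForm (x y : Fin 4 → ℚ) : ℚ := x 0 * y 1 + x 1 * y 0 + x 2 * y 3 + x 3 * y 2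

/-- The bilinear form of `II_{2,2+8k} = U² ⊕ E₈^k`. -/
def IIForm (k : ℕ) (x y : IIAmb k) : ℚ := UForm x.1 y.1 + ∑ j, negE (x.2 j) (y.2 j)

/-- The even unimodular lattice `II_{2,2+8k} = U² ⊕ E₈^k` inside its ambient space. -/
def IISet (k : ℕ) : Set (IIAmb k) := {p | IntVec p.1 ∧ ∀ j, p.2 j ∈ E8Set}

/-- `v` has divisibility `d` in `Λ_N`: all pairings with lattice vectors are divisible
by `d`, and `d` is attained. -/
def HasDiv (N : ℕ) (v : Fin (N + 2) → ℚ) (d : ℤ) : Prop :=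
  (∀ x ∈ LamSet N, ∃ a : ℤ, LamForm N v x = (d : ℚ) * a) ∧
  ∃ x ∈ LamSet N, LamForm N v x = (d : ℚ)

/-- `ξ` represents a decoration of `Λ_N`: an element of the dual lattice whose class in
the discriminant group has square `1` modulo `2ℤ`. -/
def IsDeco (N : ℕ) (ξ : Fin (N + 2) → ℚ) : Prop :=
  (∀ y ∈ LamSet N, ∃ a : ℤ, LamForm N ξ y = (a : ℚ)) ∧
  ∃ a : ℤ, LamForm N ξ ξ = 1 + 2 * (a : ℚ)


section Eichler

variable {V : Type*} [AddCommGroup V] [Module ℚ V]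

/-- Isometry of the form preserving the lattice. -/
def IsAut (B : LinearMap.BilinForm ℚ V) (Λ : AddSubgroup V) (g : V ≃ₗ[ℚ] V) : Prop :=
  (∀ y z, B (g y) (g z) = B y z) ∧ ∀ y, g y ∈ Λ ↔ y ∈ Λ

/-- Same orbit, and same class modulo the lattice. -/
def Orb (B : LinearMap.BilinForm ℚ V) (Λ : AddSubgroup V) (s s' : V) : Prop :=
  (∃ g : V ≃ₗ[ℚ] V, IsAut B Λ g ∧ g s = s') ∧ s' - s ∈ Λ

/-- Even integral lattice for a symmetric form. -/
structure EvenLat (B : LinearMap.BilinForm ℚ V) (Λ : AddSubgroup V) : Prop where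
  symm : ∀ x y, B x y = B y x
  int : ∀ x ∈ Λ, ∀ y ∈ Λ, ∃ n : ℤ, B x y = n
  even : ∀ x ∈ Λ, ∃ n : ℤ, B x x = 2 * n

lemma Orb.refl (B : LinearMap.BilinForm ℚ V) (Λ : AddSubgroup V) (s : V) : Orb B Λ s s :=
  ⟨⟨LinearEquiv.refl ℚ V, ⟨fun _ _ => rfl, fun _ => Iff.rfl⟩, rfl⟩, by simp⟩

lemma Orb.trans {B : LinearMap.BilinForm ℚ V} {Λ : AddSubgroup V} {s t u : V}
    (h1 : Orb B Λ s t) (h2 : Orb B Λ t u) : Orb B Λ s u := by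
  obtain ⟨⟨g, ⟨hg1, hg2⟩, rfl⟩, h1⟩ := h1
  obtain ⟨⟨h, ⟨hh1, hh2⟩, rfl⟩, h2⟩ := h2
  refine ⟨⟨g.trans h, ⟨fun y z => ?_, fun y => ?_⟩, rfl⟩, ?_⟩
  · simp [hh1, hg1]
  · simp [hh2, hg2]
  · have := Λ.add_mem h1 h2
    convert this using 1
    abel

lemma zsmul_mem_rat (Λ : AddSubgroup V) {x : V} (hx : x ∈ Λ) {q : ℚ} {n : ℤ} (h : q = n) :
    q • x ∈ Λ := by
  rw [h, Int.cast_smul_eq_zsmul]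
  exact Λ.zsmul_mem hx n

/-- The Eichler transvection. -/
def tv (B : LinearMap.BilinForm ℚ V) (e x : V) : V →ₗ[ℚ] V :=
  LinearMap.id - (B x).smulRight e + (B e).smulRight (x - (B x x / 2) • e)

lemma tv_apply (B : LinearMap.BilinForm ℚ V) (e x y : V) :
    tv B e x y = y - B x y • e + B e y • (x - (B x x / 2) • e) := by
  simp [tv]

lemma tv_inv (B : LinearMap.BilinForm ℚ V) (hs : ∀ x y, B x y = B y x) (e x y : V)
    (hee : B e e = 0) (hex : B e x = 0) : tv B e x (tv B e (-x) y) = y := by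
  have hxe : B x e = 0 := by rw [hs, hex]
  simp only [tv_apply, map_add, map_sub, map_smul, map_neg, LinearMap.neg_apply, smul_eq_mul,
    hee, hex, hxe]
  module

lemma tv_isom (B : LinearMap.BilinForm ℚ V) (hs : ∀ x y, B x y = B y x) (e x y z : V)
    (hee : B e e = 0) (hex : B e x = 0) : B (tv B e x y) (tv B e x z) = B y z := by
  have hxe : B x e = 0 := by rw [hs, hex]
  simp only [tv_apply, map_add, map_sub, map_smul, map_neg, LinearMap.neg_apply, smul_eq_mul,
    hee, hex, hxe, LinearMap.add_apply, LinearMap.sub_apply, LinearMap.smul_apply,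
    hs y e, hs y x]
  ring

lemma tv_diff {B : LinearMap.BilinForm ℚ V} {Λ : AddSubgroup V} (H : EvenLat B Λ)
    {e x s : V} (he : e ∈ Λ) (hx : x ∈ Λ) (hse : ∃ n : ℤ, B e s = n) (hsx : ∃ n : ℤ, B x s = n) :
    tv B e x s - s ∈ Λ := by
  obtain ⟨n, hn⟩ := hse
  obtain ⟨m, hm⟩ := hsx
  obtain ⟨q, hq⟩ := H.even x hx
  rw [tv_apply]
  have : s - B x s • e + B e s • (x - (B x x / 2) • e) - s
    = -(B x s • e) + B e s • (x - (B x x / 2) • e) := by abel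
  rw [this]
  refine Λ.add_mem (Λ.neg_mem (zsmul_mem_rat Λ he hm)) (zsmul_mem_rat Λ (Λ.sub_mem hx ?_) hn)
  exact zsmul_mem_rat Λ he (n := q) (by rw [hq]; ring)

lemma orb_tv {B : LinearMap.BilinForm ℚ V} {Λ : AddSubgroup V} (H : EvenLat B Λ)
    {e x s : V} (he : e ∈ Λ) (hx : x ∈ Λ) (hs : ∀ y ∈ Λ, ∃ n : ℤ, B y s = n)
    (hee : B e e = 0) (hex : B e x = 0) : Orb B Λ s (tv B e x s) := by
  have hex' : B e (-x) = 0 := by simp [hex]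
  have key : ∀ x' ∈ Λ, ∀ y ∈ Λ, tv B e x' y ∈ Λ := fun x' hx' y hy => by
    have := Λ.add_mem (tv_diff H he hx' (H.int e he y hy) (H.int x' hx' y hy)) hy
    simpa using this
  have hi1 : ∀ y, tv B e x (tv B e (-x) y) = y := fun y => tv_inv B H.symm e x y hee hex
  have hi2 : ∀ y, tv B e (-x) (tv B e x y) = y := fun y => by
    have := tv_inv B H.symm e (-x) y hee hex'
    simpa using this
  refine ⟨⟨LinearEquiv.ofLinearMap (tv B e x) (tv B e (-x)) (LinearMap.ext hi1) (LinearMap.ext hi2),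
    ⟨fun y z => tv_isom B H.symm e x y z hee hex, fun y => ⟨fun h => ?_, fun h => key x hx y h⟩⟩,
    rfl⟩, tv_diff H he hx (hs e he) (hs x hx)⟩
  have := key (-x) (Λ.neg_mem hx) _ h
  simpa [hi2] using this

/-- Two orthogonal hyperbolic planes in the lattice. -/
structure Frame (B : LinearMap.BilinForm ℚ V) (Λ : AddSubgroup V) (e f e' f' : V) : Prop where
  he : e ∈ Λ
  hf : f ∈ Λ
  he' : e' ∈ Λ
  hf' : f' ∈ Λ
  ee : B e e = 0
  ff : B f f = 0
  ee2 : B e' e' = 0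
  ff2 : B f' f' = 0
  ef : B e f = 1
  ef2 : B e' f' = 1
  c1 : B e e' = 0
  c2 : B e f' = 0
  c3 : B f e' = 0
  c4 : B f f' = 0

lemma Frame.swap {B : LinearMap.BilinForm ℚ V} {Λ : AddSubgroup V} (H : EvenLat B Λ)
    {e f e' f' : V} (F : Frame B Λ e f e' f') : Frame B Λ e f f' e' :=
  ⟨F.he, F.hf, F.hf', F.he', F.ee, F.ff, F.ff2, F.ee2, F.ef, by rw [H.symm, F.ef2], F.c2, F.c1,
    F.c4, F.c3⟩

/-- Dual vectors pairing to one with something. -/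
def Prim (B : LinearMap.BilinForm ℚ V) (Λ : AddSubgroup V) (s : V) : Prop :=
  (∀ y ∈ Λ, ∃ n : ℤ, B y s = n) ∧ ∃ y ∈ Λ, B y s = 1

lemma Prim.orb {B : LinearMap.BilinForm ℚ V} {Λ : AddSubgroup V}
    {s s' : V} (h : Prim B Λ s) (ho : Orb B Λ s s') : Prim B Λ s' := by
  obtain ⟨⟨g, ⟨hg1, hg2⟩, rfl⟩, -⟩ := ho
  obtain ⟨h1, y, hy, hy1⟩ := h
  refine ⟨fun z hz => ?_, g y, (hg2 y).2 hy, by rw [hg1, hy1]⟩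
  have hz' : g (g.symm z) ∈ Λ := by simpa using hz
  obtain ⟨n, hn⟩ := h1 _ ((hg2 _).1 hz')
  refine ⟨n, ?_⟩
  rw [← hn, ← hg1 (g.symm z) s, LinearEquiv.apply_symm_apply]

/-- Change the pairing with the second vector by a multiple of the pairing with the first. -/
lemma shift2 {B : LinearMap.BilinForm ℚ V} {Λ : AddSubgroup V} (H : EvenLat B Λ)
    {e f e' f' : V} (F : Frame B Λ e f e' f') {s : V} (hs : Prim B Λ s) (c : ℤ) :
    ∃ s', Orb B Λ s s' ∧ B e s' = B e s ∧ B e' s' = B e' s - c * B e s ∧ B f' s' = B f' s := by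
  have hfe : B f' e = 0 := by rw [H.symm, F.c2]
  have hee : B e' e = 0 := by rw [H.symm, F.c1]
  have o := orb_tv H F.hf' (x := (c : ℚ) • e) (zsmul_mem_rat Λ F.he rfl) hs.1 F.ff2
    (by simp [hfe])
  refine ⟨_, o, ?_, ?_, ?_⟩
  · simp [tv_apply, F.ee, F.c2]
  · simp [tv_apply, F.ee, F.ef2, hee]
  · simp [tv_apply, F.ee, F.ff2, hfe]

/-- Change the pairing with the first vector by a multiple of the pairing with the second. -/
lemma shift1 {B : LinearMap.BilinForm ℚ V} {Λ : AddSubgroup V} (H : EvenLat B Λ)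
    {e f e' f' : V} (F : Frame B Λ e f e' f') {s : V} (hs : Prim B Λ s) (c : ℤ) :
    ∃ s', Orb B Λ s s' ∧ B e s' = B e s - c * B e' s := by
  refine ⟨_, orb_tv H F.hf (x := (c : ℚ) • e') (zsmul_mem_rat Λ F.he' rfl) hs.1 F.ff ?_, ?_⟩
  · simp [F.c3]
  · simp [tv_apply, F.c1, F.ef, F.ee2]

lemma descent {B : LinearMap.BilinForm ℚ V} {Λ : AddSubgroup V} (H : EvenLat B Λ)
    {e f e' f' : V} (F : Frame B Λ e f e' f') {s : V} (hs : Prim B Λ s) {g b : ℤ}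
    (hg : B e s = g) (hb : B e' s = b) (hgb : ¬ g ∣ b) :
    ∃ s', Orb B Λ s s' ∧ ∃ g' : ℤ, B e s' = g' ∧ g' ≠ 0 ∧ (g = 0 ∨ g'.natAbs < g.natAbs) := by
  rcases eq_or_ne g 0 with h0 | h0
  · obtain ⟨s', ho, h1⟩ := shift1 H F hs 1
    refine ⟨s', ho, -b, ?_, ?_, Or.inl h0⟩
    · rw [h1, hg, hb, h0]; simp
    · rintro h; apply hgb; rw [h0]; simp; omega
  · obtain ⟨s1, ho1, h1, h2, -⟩ := shift2 H F hs (b / g)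
    obtain ⟨s2, ho2, h3⟩ := shift1 H F (hs.orb ho1) g.sign
    have hm := Int.emod_add_mul_ediv b g
    have hpos := Int.emod_nonneg b h0
    have hlt := Int.emod_lt_abs b h0
    have hne : b % g ≠ 0 := fun h => hgb (Int.dvd_of_emod_eq_zero h)
    have e1 : B e' s1 = ((b % g : ℤ) : ℚ) := by
      rw [h2, hb, hg]
      have : b % g = b - b / g * g := by linarith [mul_comm (b / g) g]
      rw [this]; push_cast; ring
    refine ⟨s2, ho1.trans ho2, g - g.sign * (b % g), ?_, ?_, Or.inr ?_⟩
    · rw [h3, h1, hg, e1]; push_cast; ring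
    · rcases lt_or_gt_of_ne h0 with h | h
      · rw [Int.sign_eq_neg_one_of_neg h]; rw [abs_of_neg h] at hlt; omega
      · rw [Int.sign_eq_one_of_pos h]; rw [abs_of_pos h] at hlt; omega
    · rcases lt_or_gt_of_ne h0 with h | h
      · rw [Int.sign_eq_neg_one_of_neg h]; rw [abs_of_neg h] at hlt; omega
      · rw [Int.sign_eq_one_of_pos h]; rw [abs_of_pos h] at hlt; omega

lemma dvd_all {B : LinearMap.BilinForm ℚ V} {Λ : AddSubgroup V} (H : EvenLat B Λ)
    {e f e' f' : V} (F : Frame B Λ e f e' f') {s : V} (hs : Prim B Λ s) {g : ℤ}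
    (hg : B e s = g)
    (hQ : ∀ s', Orb B Λ s s' → B e s' = g → ∀ b : ℤ, B e' s' = b ∨ B f' s' = b → g ∣ b) :
    g ∣ 1 := by
  obtain ⟨b, hb⟩ := hs.1 e' F.he'
  obtain ⟨c, hc⟩ := hs.1 f' F.hf'
  obtain ⟨b', rfl⟩ := hQ s (Orb.refl _ _ _) hg b (Or.inl hb)
  obtain ⟨c', rfl⟩ := hQ s (Orb.refl _ _ _) hg c (Or.inr hc)
  obtain ⟨s1, o1, h1, h2, h3⟩ := shift2 H F hs b'
  have p1 := hs.orb o1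
  obtain ⟨s2, o2, h4, h5, h6⟩ := shift2 H (F.swap H) p1 c'
  have p2 := p1.orb o2
  have z1 : B e s2 = g := by rw [h4, h1, hg]
  have z2 : B e' s2 = 0 := by rw [h6, h2, hb, hg]; push_cast; ring
  have z3 : B f' s2 = 0 := by rw [h5, h3, hc, h1, hg]; push_cast; ring
  obtain ⟨y, hy, hy1⟩ := p2.2
  obtain ⟨n1, hn1⟩ := H.int e' F.he' y hy
  obtain ⟨n2, hn2⟩ := H.int f' F.hf' y hy
  -- component of y orthogonal to the second plane
  have hx : y - B f' y • e' - B e' y • f' ∈ Λ :=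
    Λ.sub_mem (Λ.sub_mem hy (zsmul_mem_rat Λ F.he' hn2)) (zsmul_mem_rat Λ F.hf' hn1)
  set x := y - B f' y • e' - B e' y • f' with hxdef
  have hfe : B f' e' = 1 := by rw [H.symm, F.ef2]
  have hfx : B f' x = 0 := by simp [hxdef, hfe, F.ff2]
  have hxs : B x s2 = 1 := by simp [hxdef, hy1, z2, z3]
  have o3 := orb_tv H F.hf' hx p2.1 F.ff2 hfx
  have := hQ _ ((o1.trans o2).trans o3) (by simp [tv_apply, F.c2, z3, z1]) (-1)
    (Or.inl (by simp [tv_apply, z2, z3, hxs, F.ef2]))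
  simpa using this

lemma to_unit {B : LinearMap.BilinForm ℚ V} {Λ : AddSubgroup V} (H : EvenLat B Λ)
    {e f e' f' : V} (F : Frame B Λ e f e' f') {s : V} (hs : Prim B Λ s) :
    ∃ s', Orb B Λ s s' ∧ (B e s' = 1 ∨ B e s' = -1) := by
  have fin : ∀ s', Orb B Λ s s' → ∀ g : ℤ, B e s' = g → g ∣ 1 →
      ∃ s', Orb B Λ s s' ∧ (B e s' = 1 ∨ B e s' = -1) := by
    intro s' ho g hg hd
    refine ⟨s', ho, ?_⟩
    rcases Int.isUnit_iff.1 (isUnit_of_dvd_one hd) with h | h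
    · left; rw [hg, h]; simp
    · right; rw [hg, h]; simp
  by_cases hex : ∃ n : ℕ, ∃ s', Orb B Λ s s' ∧ ∃ g : ℤ, B e s' = g ∧ g ≠ 0 ∧ g.natAbs = n
  · classical
    obtain ⟨s1, o1, g, hg, hg0, hgn⟩ := Nat.find_spec hex
    refine fin s1 o1 g hg (dvd_all H F (hs.orb o1) hg ?_)
    intro s2 o2 hg2 b hb
    by_contra hnd
    have : ∃ s', Orb B Λ s2 s' ∧ ∃ g' : ℤ, B e s' = g' ∧ g' ≠ 0 ∧
        (g = 0 ∨ g'.natAbs < g.natAbs) := by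
      rcases hb with hb | hb
      · exact descent H F ((hs.orb o1).orb o2) hg2 hb hnd
      · exact descent H (F.swap H) ((hs.orb o1).orb o2) hg2 hb hnd
    obtain ⟨s3, o3, g', h1, h2, h3⟩ := this
    rcases h3 with h3 | h3
    · exact hg0 h3
    · rw [hgn] at h3
      exact Nat.find_min hex h3 ⟨s3, (o1.trans o2).trans o3, g', h1, h2, rfl⟩
  · obtain ⟨g, hg⟩ := hs.1 e F.he
    refine fin s (Orb.refl _ _ _) g hg (dvd_all H F hs hg ?_)
    intro s2 o2 hg2 b hb
    by_contra hnd
    have : ∃ s', Orb B Λ s2 s' ∧ ∃ g' : ℤ, B e s' = g' ∧ g' ≠ 0 ∧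
        (g = 0 ∨ g'.natAbs < g.natAbs) := by
      rcases hb with hb | hb
      · exact descent H F (hs.orb o2) hg2 hb hnd
      · exact descent H (F.swap H) (hs.orb o2) hg2 hb hnd
    obtain ⟨s3, o3, g', h1, h2, h3⟩ := this
    exact hex ⟨_, s3, o2.trans o3, g', h1, h2, rfl⟩

/-- Eichler criterion for roots of divisibility two. -/
theorem eichler {B : LinearMap.BilinForm ℚ V} {Λ : AddSubgroup V} (H : EvenLat B Λ)
    {e f e' f' : V} (F : Frame B Λ e f e' f') {a r : V} (ha : a ∈ Λ) (hr : r ∈ Λ)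
    (ha2 : B a a = -2) (hr2 : B r r = -2) (hrd : ∀ y ∈ Λ, ∃ n : ℤ, B y r = 2 * n)
    (hea : B e a = 0) (hfa : B f a = 0) (hra : (1 / 2 : ℚ) • (r - a) ∈ Λ) :
    ∃ g : V ≃ₗ[ℚ] V, IsAut B Λ g ∧ g a = r := by
  have hs : Prim B Λ ((1 / 2 : ℚ) • r) := by
    refine ⟨fun y hy => ?_, -r, Λ.neg_mem hr, by simp [hr2]⟩
    obtain ⟨n, hn⟩ := hrd y hy
    exact ⟨n, by simp [hn]⟩
  obtain ⟨s, o1, hu⟩ := to_unit H F hs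
  have hps := hs.orb o1
  obtain ⟨ε, hε, hε2⟩ : ∃ ε : ℤ, B e s = ε ∧ (ε : ℚ) * ε = 1 := by
    rcases hu with h | h
    · exact ⟨1, by simp [h], by simp⟩
    · exact ⟨-1, by simp [h], by simp⟩
  have hss : B s s = -1 / 2 := by
    obtain ⟨⟨g, ⟨hg1, -⟩, rfl⟩, -⟩ := o1
    rw [hg1]; simp [hr2]; norm_num
  have hz : s - (1 / 2 : ℚ) • a ∈ Λ := by
    have := Λ.add_mem o1.2 hra
    convert this using 1
    module
  set z := s - (1 / 2 : ℚ) • a with hzdef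
  have hez : B e z = ε := by simp [hzdef, hε, hea]
  obtain ⟨m, hm⟩ := H.int f F.hf z hz
  have hfe : B f e = 1 := by rw [H.symm, F.ef]
  have hx : (-ε : ℚ) • (z - B f z • e - B e z • f) ∈ Λ :=
    zsmul_mem_rat Λ (Λ.sub_mem (Λ.sub_mem hz (zsmul_mem_rat Λ F.he hm))
      (zsmul_mem_rat Λ F.hf hez)) (n := -ε) (by simp)
  set x := (-ε : ℚ) • (z - B f z • e - B e z • f) with hxdef
  have hex : B e x = 0 := by simp [hxdef, F.ee, F.ef]
  have o2 := orb_tv H F.he hx hps.1 F.ee hex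
  have hres : ∃ θ : ℚ, tv B e x s = (1 / 2 : ℚ) • a + (ε : ℚ) • f + θ • e := by
    refine ⟨-(B x s) - ε * (B x x / 2) + B f z, ?_⟩
    have h1 : tv B e x s = s - B x s • e + (ε : ℚ) • (x - (B x x / 2) • e) := by
      rw [tv_apply, hε]
    have h2 : (ε : ℚ) • x = -(z - B f z • e - B e z • f) := by
      rw [hxdef, smul_smul, mul_neg, hε2, neg_smul, one_smul]
    rw [h1, smul_sub, h2, hez, hzdef]
    module
  obtain ⟨θ, hθ⟩ := hres
  have hnorm : B (tv B e x s) (tv B e x s) = -1 / 2 := by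
    rw [tv_isom B H.symm e x s s F.ee hex, hss]
  have hae : B a e = 0 := by rw [H.symm, hea]
  have haf : B a f = 0 := by rw [H.symm, hfa]
  have hθ0 : θ = 0 := by
    rw [hθ] at hnorm
    simp [F.ee, F.ff, F.ef, hfe, hea, hfa, hae, haf, ha2] at hnorm
    have h3 : (ε : ℚ) * θ = 0 := by linarith
    have h4 : (ε : ℚ) ≠ 0 := by rintro h; rw [h] at hε2; simp at hε2
    exact (mul_eq_zero.1 h3).resolve_left h4
  rw [hθ0, zero_smul, add_zero] at hθ
  rw [hθ] at o2
  have hp2 := hps.orb o2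
  have o3 := orb_tv H F.hf (x := (-ε : ℚ) • a) (zsmul_mem_rat Λ ha (n := -ε) (by simp))
    hp2.1 F.ff (by simp [hfa])
  have hlast : tv B f ((-ε : ℚ) • a) ((1 / 2 : ℚ) • a + (ε : ℚ) • f) = (1 / 2 : ℚ) • a := by
    rw [tv_apply]
    simp [hfa, F.ff, haf, ha2]
  rw [hlast] at o3
  obtain ⟨⟨g, ⟨hg1, hg2⟩, hg3⟩, -⟩ := (o1.trans o2).trans o3
  have hgr : g r = a := by
    have : (1 / 2 : ℚ) • g r = (1 / 2 : ℚ) • a := by rw [← map_smul, hg3]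
    exact smul_right_injective V (by norm_num : (1 / 2 : ℚ) ≠ 0) this
  refine ⟨g.symm, ⟨fun y z => ?_, fun y => ?_⟩, by rw [← hgr]; simp⟩
  · rw [← hg1]; simp
  · rw [← hg2]; simp

end Eichler

section Blocks

/-- Ambient space of `U² ⊕ E₈^k ⊕ ℤ²`. -/
abbrev AA (k : ℕ) := IIAmb k × (ℚ × ℚ)

/-- The form on `AA k`. -/
def AForm (k : ℕ) (p q : AA k) : ℚ := IIForm k p.1 q.1 - p.2.1 * q.2.1 - p.2.2 * q.2.2

/-- The lattice with `E₈` blocks at the indices in `S` and `ℤ⁸` blocks elsewhere. -/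
def LS {k : ℕ} (S : Finset (Fin k)) : Set (AA k) :=
  {p | IntVec p.1.1 ∧ (∀ j, if j ∈ S then p.1.2 j ∈ E8Set else IntVec (p.1.2 j)) ∧
    (∃ a : ℤ, p.2.1 = a) ∧ ∃ b : ℤ, p.2.2 = b}

/-- From an `E₈` block to a `ℤ⁸` block. -/
def bkFun {k : ℕ} (j : Fin k) (p : AA k) : AA k :=
  ((![2 * (p.1.1 0 - p.1.2 j 0 - p.2.1 + p.1.1 1),
      p.1.1 1 - (∑ r, p.1.2 j r) / 2 + 2 * (p.1.1 0 - p.1.2 j 0 - p.2.1 + p.1.1 1),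
      p.1.1 2, p.1.1 3],
    fun i => if i = j then (fun r => p.1.2 j r - (p.1.1 0 - p.1.2 j 0 - p.2.1 + p.1.1 1)
      - (if r = 0 then p.1.1 1 else 0)) else p.1.2 i),
   (p.2.1 - p.1.1 1, p.2.2))

/-- From a `ℤ⁸` block to an `E₈` block. -/
def fwFun {k : ℕ} (j : Fin k) (p : AA k) : AA k :=
  ((![p.1.1 0 + p.1.2 j 0 + p.2.1 + (2 * p.1.1 1 + ∑ r, p.1.2 j r + 2 * p.1.1 0),
      2 * p.1.1 1 + ∑ r, p.1.2 j r + 2 * p.1.1 0,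
      p.1.1 2, p.1.1 3],
    fun i => if i = j then (fun r => p.1.2 j r + p.1.1 0 / 2
      + (if r = 0 then (2 * p.1.1 1 + ∑ r, p.1.2 j r + 2 * p.1.1 0) else 0)) else p.1.2 i),
   (p.2.1 + (2 * p.1.1 1 + ∑ r, p.1.2 j r + 2 * p.1.1 0), p.2.2))

lemma AA_ext {k : ℕ} {p q : AA k} (h0 : p.1.1 0 = q.1.1 0) (h1 : p.1.1 1 = q.1.1 1)
    (h2 : p.1.1 2 = q.1.1 2) (h3 : p.1.1 3 = q.1.1 3) (hm : ∀ i r, p.1.2 i r = q.1.2 i r)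
    (hs : p.2.1 = q.2.1) (ht : p.2.2 = q.2.2) : p = q := by
  refine Prod.ext (Prod.ext ?_ ?_) (Prod.ext hs ht)
  · funext i; fin_cases i <;> assumption
  · funext i r; exact hm i r

lemma fw_bk {k : ℕ} (j : Fin k) (p : AA k) : fwFun j (bkFun j p) = p := by
  apply AA_ext
  · simp [fwFun, bkFun, Fin.sum_univ_eight]; ring
  · simp [fwFun, bkFun, Fin.sum_univ_eight]; ring
  · simp [fwFun, bkFun]
  · simp [fwFun, bkFun]
  · intro i r
    by_cases h : i = j
    · subst h
      by_cases hr : r = 0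
      · subst hr
        simp [fwFun, bkFun, Fin.sum_univ_eight]; ring
      · simp [fwFun, bkFun, hr]
    · simp [fwFun, bkFun, h]
  · simp [fwFun, bkFun, Fin.sum_univ_eight]; ring
  · simp [fwFun, bkFun]

lemma bk_fw {k : ℕ} (j : Fin k) (p : AA k) : bkFun j (fwFun j p) = p := by
  apply AA_ext
  · simp [fwFun, bkFun, Fin.sum_univ_eight]; ring
  · simp [fwFun, bkFun, Fin.sum_univ_eight]; ring
  · simp [fwFun, bkFun]
  · simp [fwFun, bkFun]
  · intro i r
    by_cases h : i = j
    · subst h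
      by_cases hr : r = 0
      · subst hr
        simp [fwFun, bkFun, Fin.sum_univ_eight]; ring
      · simp [fwFun, bkFun, hr]; ring
    · simp [fwFun, bkFun, h]
  · simp [fwFun, bkFun, Fin.sum_univ_eight]
  · simp [fwFun, bkFun]

/-- The block isometry. -/
def bk {k : ℕ} (j : Fin k) : AA k ≃ₗ[ℚ] AA k where
  toFun := bkFun j
  invFun := fwFun j
  left_inv := fw_bk j
  right_inv := bk_fw j
  map_add' := by
    intro p q
    apply AA_ext
    · simp [bkFun]; ring
    · simp [bkFun, Finset.sum_add_distrib]; ring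
    · simp [bkFun]
    · simp [bkFun]
    · intro i r
      by_cases h : i = j
      · subst h
        by_cases hr : r = 0
        · subst hr; simp [bkFun]; ring
        · simp [bkFun, hr]; ring
      · simp [bkFun, h]
    · simp [bkFun]; ring
    · simp [bkFun]
  map_smul' := by
    intro c p
    apply AA_ext
    · simp [bkFun]; ring
    · simp [bkFun, ← Finset.mul_sum]; ring
    · simp [bkFun]
    · simp [bkFun]
    · intro i r
      by_cases h : i = j
      · subst h
        by_cases hr : r = 0
        · subst hr; simp [bkFun]; ring
        · simp [bkFun, hr]; ring
      · simp [bkFun, h]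
    · simp [bkFun]; ring
    · simp [bkFun]

lemma bk_isom {k : ℕ} (j : Fin k) (p q : AA k) : AForm k (bk j p) (bk j q) = AForm k p q := by
  have hb : ∀ p, bk j p = bkFun j p := fun _ => rfl
  simp only [AForm, IIForm, hb]
  rw [← Finset.add_sum_erase _ (fun i => negE ((bkFun j p).1.2 i) ((bkFun j q).1.2 i))
      (Finset.mem_univ j),
    ← Finset.add_sum_erase _ (fun i => negE (p.1.2 i) (q.1.2 i)) (Finset.mem_univ j)]
  have : ∑ i ∈ Finset.univ.erase j, negE ((bkFun j p).1.2 i) ((bkFun j q).1.2 i)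
      = ∑ i ∈ Finset.univ.erase j, negE (p.1.2 i) (q.1.2 i) := by
    refine Finset.sum_congr rfl fun i hi => ?_
    have : i ≠ j := Finset.ne_of_mem_erase hi
    simp [bkFun, this]
  rw [this]
  simp [bkFun, UForm, negE, Fin.sum_univ_eight]
  ring

lemma int_mem_iff {q : ℚ} : (∃ a : ℤ, q = a) ↔ q ∈ (Int.castAddHom ℚ).range :=
  ⟨fun ⟨a, h⟩ => ⟨a, h.symm⟩, fun ⟨a, h⟩ => ⟨a, h.symm⟩⟩

lemma isInt_add {x y : ℚ} (hx : ∃ a : ℤ, x = a) (hy : ∃ a : ℤ, y = a) : ∃ a : ℤ, x + y = a := by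
  obtain ⟨a, rfl⟩ := hx; obtain ⟨b, rfl⟩ := hy; exact ⟨a + b, by push_cast; ring⟩

lemma isInt_sub {x y : ℚ} (hx : ∃ a : ℤ, x = a) (hy : ∃ a : ℤ, y = a) : ∃ a : ℤ, x - y = a := by
  obtain ⟨a, rfl⟩ := hx; obtain ⟨b, rfl⟩ := hy; exact ⟨a - b, by push_cast; ring⟩

lemma isInt_sum {ι : Type*} (s : Finset ι) {f : ι → ℚ} (h : ∀ i ∈ s, ∃ a : ℤ, f i = a) :
    ∃ a : ℤ, ∑ i ∈ s, f i = a := by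
  rw [int_mem_iff]
  exact AddSubgroup.sum_mem _ fun i hi => int_mem_iff.1 (h i hi)

lemma bk_mem {k : ℕ} {j : Fin k} {S : Finset (Fin k)} (hj : j ∉ S) (p : AA k)
    (hp : p ∈ LS (insert j S)) : bkFun j p ∈ LS S := by
  obtain ⟨hu, hm, hs, ht⟩ := hp
  have hmj := hm j
  simp only [Finset.mem_insert, true_or, if_true] at hmj
  obtain ⟨hE, n, hn⟩ := hmj
  -- the shifted block is integral
  have hg : (∀ r, ∃ a : ℤ, p.1.2 j r - (p.1.1 0 - p.1.2 j 0 - p.2.1 + p.1.1 1) = a) ∧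
      ∃ a : ℤ, 2 * (p.1.1 0 - p.1.2 j 0 - p.2.1 + p.1.1 1) = a := by
    obtain ⟨a0, h0⟩ := hu 0
    obtain ⟨a1, h1⟩ := hu 1
    obtain ⟨s, hs⟩ := hs
    rw [h0, h1, hs]
    rcases hE with hE | hE
    · obtain ⟨b, hb⟩ := hE 0
      refine ⟨fun r => ?_, 2 * (a0 - b - s + a1), ?_⟩
      · obtain ⟨c, hc⟩ := hE r
        exact ⟨c - (a0 - b - s + a1), by rw [hb, hc]; push_cast; ring⟩
      · rw [hb]; push_cast; ring
    · obtain ⟨b, hb⟩ := hE 0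
      simp only [Pi.sub_apply, halfVec] at hb
      refine ⟨fun r => ?_, 2 * (a0 - b - s + a1) - 1, ?_⟩
      · obtain ⟨c, hc⟩ := hE r
        simp only [Pi.sub_apply, halfVec] at hc
        exact ⟨c - (a0 - b - s + a1) + 1, by push_cast; linarith⟩
      · push_cast; linarith
  refine ⟨?_, ?_, ?_, ?_⟩
  · intro i
    fin_cases i
    · exact hg.2
    · have : ∃ a : ℤ, p.1.1 1 - (∑ r, p.1.2 j r) / 2 = a :=
        isInt_sub (hu 1) ⟨n, by rw [hn]; ring⟩
      exact isInt_add this hg.2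
    · exact hu 2
    · exact hu 3
  · intro i
    by_cases h : i = j
    · subst h
      rw [if_neg hj]
      intro r
      simp only [bkFun, if_true]
      refine isInt_sub (hg.1 r) ?_
      split_ifs
      · exact hu 1
      · exact ⟨0, by simp⟩
    · have := hm i
      simpa [bkFun, h] using this
  · exact isInt_sub hs (hu 1)
  · exact ht

lemma fw_mem {k : ℕ} {j : Fin k} {S : Finset (Fin k)} (hj : j ∉ S) (p : AA k)
    (hp : p ∈ LS S) : fwFun j p ∈ LS (insert j S) := by
  obtain ⟨hu, hm, hs, ht⟩ := hp
  have hmj := hm j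
  rw [if_neg hj] at hmj
  have hsum : ∃ a : ℤ, ∑ r, p.1.2 j r = a := isInt_sum _ fun r _ => hmj r
  have hb : ∃ a : ℤ, 2 * p.1.1 1 + ∑ r, p.1.2 j r + 2 * p.1.1 0 = a := by
    obtain ⟨a0, h0⟩ := hu 0
    obtain ⟨a1, h1⟩ := hu 1
    obtain ⟨c, hc⟩ := hsum
    exact ⟨2 * a1 + c + 2 * a0, by rw [h0, h1, hc]; push_cast; ring⟩
  refine ⟨?_, ?_, ?_, ?_⟩
  · intro i
    fin_cases i
    · exact isInt_add (isInt_add (isInt_add (hu 0) (hmj 0)) hs) hb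
    · exact hb
    · exact hu 2
    · exact hu 3
  · intro i
    by_cases h : i = j
    · subst h
      rw [if_pos (Finset.mem_insert_self _ _)]
      obtain ⟨a0, h0⟩ := hu 0
      have hd : ∀ r : Fin 8, ∃ a : ℤ, (if r = 0 then
          (2 * p.1.1 1 + ∑ r, p.1.2 i r + 2 * p.1.1 0) else 0) = a := by
        intro r
        split_ifs
        · exact hb
        · exact ⟨0, by simp⟩
      constructor
      · rcases Int.even_or_odd' a0 with ⟨c, hc | hc⟩
        · left
          intro r
          simp only [fwFun, if_true]
          exact isInt_add (isInt_add (hmj r) ⟨c, by rw [h0, hc]; push_cast; ring⟩) (hd r)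
        · right
          intro r
          simp only [fwFun, if_true, Pi.sub_apply, halfVec]
          obtain ⟨a, ha⟩ := isInt_add (isInt_add (hmj r) ⟨c, rfl⟩) (hd r)
          refine ⟨a, ?_⟩
          rw [← ha]
          have : p.1.1 0 / 2 = c + 1 / 2 := by rw [h0, hc]; push_cast; ring
          rw [this]; ring
      · obtain ⟨a1, h1⟩ := hu 1
        obtain ⟨c, hc⟩ := hsum
        refine ⟨c + a1 + 3 * a0, ?_⟩
        simp only [fwFun, if_true, Finset.sum_add_distrib, Finset.sum_ite_eq', Finset.mem_univ]
        rw [hc, h0, h1]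
        simp
        ring
    · have := hm i
      simpa [fwFun, h] using this
  · exact isInt_add hs hb
  · exact ht

lemma exists_block {k : ℕ} (S : Finset (Fin k)) : ∃ T : AA k ≃ₗ[ℚ] AA k,
    (∀ p q, AForm k (T p) (T q) = AForm k p q) ∧ ∀ p, T p ∈ LS (∅ : Finset (Fin k)) ↔ p ∈ LS S := by
  classical
  induction S using Finset.induction_on with
  | empty => exact ⟨LinearEquiv.refl _ _, fun _ _ => rfl, fun _ => Iff.rfl⟩
  | insert j S hj ih =>
    obtain ⟨T, h1, h2⟩ := ih
    refine ⟨(bk j).trans T, fun p q => ?_, fun p => ?_⟩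
    · rw [LinearEquiv.trans_apply, LinearEquiv.trans_apply, h1, bk_isom]
    · rw [LinearEquiv.trans_apply, h2]
      refine ⟨fun h => ?_, fun h => bk_mem hj p h⟩
      have := fw_mem hj _ h
      rwa [show fwFun j (bk j p) = p from fw_bk j p] at this

end Blocks

section Lam

/-- The form as a bilinear form. -/
def LamB (N : ℕ) : LinearMap.BilinForm ℚ (Fin (N + 2) → ℚ) :=
  LinearMap.mk₂ ℚ (LamForm N)
    (by
      intro x x' y
      have : ∑ i : Fin (N + 2), (if 4 ≤ (i : ℕ) then (x + x') i * y i else 0)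
        = ∑ i : Fin (N + 2), (if 4 ≤ (i : ℕ) then x i * y i else 0)
          + ∑ i : Fin (N + 2), (if 4 ≤ (i : ℕ) then x' i * y i else 0) := by
        rw [← Finset.sum_add_distrib]
        refine Finset.sum_congr rfl fun i _ => ?_
        split_ifs <;> simp [add_mul]
      simp only [LamForm]; rw [this]; simp only [Pi.add_apply]; ring)
    (by
      intro c x y
      have : ∑ i : Fin (N + 2), (if 4 ≤ (i : ℕ) then (c • x) i * y i else 0)
        = c * ∑ i : Fin (N + 2), (if 4 ≤ (i : ℕ) then x i * y i else 0) := by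
        rw [Finset.mul_sum]
        refine Finset.sum_congr rfl fun i _ => ?_
        split_ifs <;> simp [mul_assoc]
      simp only [LamForm]; rw [this]; simp only [Pi.smul_apply, smul_eq_mul]; ring)
    (by
      intro y x x'
      have : ∑ i : Fin (N + 2), (if 4 ≤ (i : ℕ) then y i * (x + x') i else 0)
        = ∑ i : Fin (N + 2), (if 4 ≤ (i : ℕ) then y i * x i else 0)
          + ∑ i : Fin (N + 2), (if 4 ≤ (i : ℕ) then y i * x' i else 0) := by
        rw [← Finset.sum_add_distrib]
        refine Finset.sum_congr rfl fun i _ => ?_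
        split_ifs <;> simp [mul_add]
      simp only [LamForm]; rw [this]; simp only [Pi.add_apply]; ring)
    (by
      intro c y x
      have : ∑ i : Fin (N + 2), (if 4 ≤ (i : ℕ) then y i * (c • x) i else 0)
        = c * ∑ i : Fin (N + 2), (if 4 ≤ (i : ℕ) then y i * x i else 0) := by
        rw [Finset.mul_sum]
        refine Finset.sum_congr rfl fun i _ => ?_
        split_ifs <;> simp [mul_left_comm]
      simp only [LamForm]; rw [this]; simp only [Pi.smul_apply, smul_eq_mul]; ring)

lemma LamB_apply (N : ℕ) (x y : Fin (N + 2) → ℚ) : LamB N x y = LamForm N x y := rfl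

lemma LamForm_symm (N : ℕ) (x y : Fin (N + 2) → ℚ) : LamForm N x y = LamForm N y x := by
  have : ∑ i : Fin (N + 2), (if 4 ≤ (i : ℕ) then x i * y i else 0)
      = ∑ i : Fin (N + 2), (if 4 ≤ (i : ℕ) then y i * x i else 0) :=
    Finset.sum_congr rfl fun i _ => by rw [mul_comm]
  simp only [LamForm, this]; ring

/-- The lattice as a subgroup. -/
def LamL (N : ℕ) : AddSubgroup (Fin (N + 2) → ℚ) where
  carrier := LamSet N
  zero_mem' := ⟨fun i => ⟨0, by simp⟩, 0, by simp⟩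
  add_mem' := by
    rintro x y ⟨hx, a, ha⟩ ⟨hy, b, hb⟩
    refine ⟨fun i => isInt_add (hx i) (hy i), a + b, ?_⟩
    have : ∑ i : Fin (N + 2), (if 4 ≤ (i : ℕ) then (x + y) i else 0)
        = ∑ i : Fin (N + 2), (if 4 ≤ (i : ℕ) then x i else 0)
          + ∑ i : Fin (N + 2), (if 4 ≤ (i : ℕ) then y i else 0) := by
        rw [← Finset.sum_add_distrib]
        refine Finset.sum_congr rfl fun i _ => ?_
        split_ifs <;> simp
    rw [this, ha, hb]; push_cast; ring
  neg_mem' := by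
    rintro x ⟨hx, a, ha⟩
    refine ⟨fun i => ?_, -a, ?_⟩
    · obtain ⟨n, hn⟩ := hx i
      exact ⟨-n, by simp [hn]⟩
    · have : ∑ i : Fin (N + 2), (if 4 ≤ (i : ℕ) then (-x) i else 0)
        = -∑ i : Fin (N + 2), (if 4 ≤ (i : ℕ) then x i else 0) := by
        rw [← Finset.sum_neg_distrib]
        refine Finset.sum_congr rfl fun i _ => ?_
        split_ifs <;> simp
      rw [this, ha]; push_cast; ring

lemma mem_LamL (N : ℕ) (x : Fin (N + 2) → ℚ) : x ∈ LamL N ↔ x ∈ LamSet N := Iff.rfl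

/-- Coordinate sum on the `D` part. -/
def dsum (N : ℕ) (x : Fin (N + 2) → ℚ) : ℚ :=
  ∑ i : Fin (N + 2), if 4 ≤ (i : ℕ) then x i else 0

lemma isInt_mul {x y : ℚ} (hx : ∃ a : ℤ, x = a) (hy : ∃ a : ℤ, y = a) : ∃ a : ℤ, x * y = a := by
  obtain ⟨a, rfl⟩ := hx; obtain ⟨b, rfl⟩ := hy; exact ⟨a * b, by push_cast; ring⟩

lemma isEven_sum {ι : Type*} (s : Finset ι) {f : ι → ℚ} (h : ∀ i ∈ s, ∃ a : ℤ, f i = 2 * a) :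
    ∃ a : ℤ, ∑ i ∈ s, f i = 2 * a := by
  obtain ⟨a, ha⟩ := isInt_sum s (f := fun i => f i / 2) fun i hi => by
    obtain ⟨a, ha⟩ := h i hi
    exact ⟨a, by rw [ha]; ring⟩
  refine ⟨a, ?_⟩
  rw [← ha, ← Finset.sum_div]; ring

lemma sq_sub_even {x : ℚ} (hx : ∃ a : ℤ, x = a) : ∃ a : ℤ, x * x - x = 2 * a := by
  obtain ⟨a, rfl⟩ := hx
  obtain ⟨c, hc⟩ := (Int.even_mul_pred_self a)
  refine ⟨c, ?_⟩
  have : ((a * (a - 1) : ℤ) : ℚ) = ((c + c : ℤ) : ℚ) := by rw [hc]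
  push_cast at this
  linarith

lemma norm_parity (N : ℕ) {x : Fin (N + 2) → ℚ} (hx : IntVec x) :
    ∃ n m : ℤ, dsum N x = n ∧ LamForm N x x = 2 * m + n := by
  obtain ⟨n, hn⟩ : ∃ n : ℤ, dsum N x = n := isInt_sum _ fun i _ => by
    split_ifs
    · exact hx i
    · exact ⟨0, by simp⟩
  obtain ⟨c, hc⟩ := isInt_add (isInt_mul (hx 0) (hx 1)) (isInt_mul (hx 2) (hx 3))
  obtain ⟨m, hm⟩ : ∃ m : ℤ, ∑ i : Fin (N + 2), (if 4 ≤ (i : ℕ) then x i * x i - x i else 0)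
      = 2 * m := isEven_sum _ fun i _ => by
    split_ifs
    · exact sq_sub_even (hx i)
    · exact ⟨0, by simp⟩
  have hsplit : ∑ i : Fin (N + 2), (if 4 ≤ (i : ℕ) then x i * x i - x i else 0)
      = ∑ i : Fin (N + 2), (if 4 ≤ (i : ℕ) then x i * x i else 0) - dsum N x := by
    rw [dsum, ← Finset.sum_sub_distrib]
    refine Finset.sum_congr rfl fun i _ => ?_
    split_ifs <;> simp
  refine ⟨n, c - m - n, hn, ?_⟩
  rw [hm, hn] at hsplit
  simp only [LamForm]
  push_cast
  linarith

lemma mem_Lam_iff (N : ℕ) {x : Fin (N + 2) → ℚ} (hx : IntVec x) :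
    x ∈ LamSet N ↔ ∃ n : ℤ, LamForm N x x = 2 * n := by
  obtain ⟨n, m, h1, h2⟩ := norm_parity N hx
  constructor
  · rintro ⟨-, a, ha⟩
    change dsum N x = _ at ha
    exact ⟨m + a, by rw [h2, ← h1, ha]; push_cast; ring⟩
  · rintro ⟨a, ha⟩
    refine ⟨hx, a - m, ?_⟩
    change dsum N x = _
    rw [h1]; push_cast; linarith

lemma add_mem_of_not_mem (N : ℕ) {x y : Fin (N + 2) → ℚ} (hx : IntVec x) (hy : IntVec y)
    (hx' : x ∉ LamSet N) (hy' : y ∉ LamSet N) : x + y ∈ LamSet N := by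
  obtain ⟨n, m, h1, -⟩ := norm_parity N hx
  obtain ⟨n', m', h1', -⟩ := norm_parity N hy
  have key : ∀ {z : Fin (N + 2) → ℚ} {n : ℤ}, IntVec z → dsum N z = n → z ∉ LamSet N →
      ∃ c, n = 2 * c + 1 := by
    intro z n hz hzn hzl
    rcases Int.even_or_odd' n with ⟨c, hc | hc⟩
    · exact absurd ⟨hz, c, by change dsum N z = _; rw [hzn, hc]; push_cast; ring⟩ hzl
    · exact ⟨c, hc⟩
  obtain ⟨c, hc⟩ := key hx h1 hx'
  obtain ⟨c', hc'⟩ := key hy h1' hy'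
  refine ⟨fun i => isInt_add (hx i) (hy i), c + c' + 1, ?_⟩
  have : ∑ i : Fin (N + 2), (if 4 ≤ (i : ℕ) then (x + y) i else 0)
        = dsum N x + dsum N y := by
    rw [dsum, dsum, ← Finset.sum_add_distrib]
    refine Finset.sum_congr rfl fun i _ => ?_
    split_ifs <;> simp
  rw [this, h1, h1', hc, hc']; push_cast; ring

lemma LamForm_int (N : ℕ) {x y : Fin (N + 2) → ℚ} (hx : IntVec x) (hy : IntVec y) :
    ∃ n : ℤ, LamForm N x y = n := by
  refine isInt_sub ?_ (isInt_sum _ fun i _ => ?_)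
  · exact isInt_add (isInt_add (isInt_add (isInt_mul (hx 0) (hy 1)) (isInt_mul (hx 1) (hy 0)))
      (isInt_mul (hx 2) (hy 3))) (isInt_mul (hx 3) (hy 2))
  · split_ifs
    · exact isInt_mul (hx i) (hy i)
    · exact ⟨0, by simp⟩

lemma Lam_even (N : ℕ) : EvenLat (LamB N) (LamL N) :=
  ⟨LamForm_symm N, fun _ hx _ hy => LamForm_int N hx.1 hy.1, fun _ hx => (mem_Lam_iff N hx.1).1 hx⟩

lemma LamForm_single (N : ℕ) (hN : 4 ≤ N) (i : Fin (N + 2)) (hi : 4 ≤ (i : ℕ))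
    (c : Fin (N + 2) → ℚ) : LamForm N (Pi.single i 1) c = - c i := by
  have h0 : (0 : Fin (N + 2)) ≠ i := by rintro rfl; simp at hi
  have h1 : (1 : Fin (N + 2)) ≠ i := by rintro rfl; simp at hi
  have h2 : (2 : Fin (N + 2)) ≠ i := by
    rintro rfl
    have : ((2 : Fin (N + 2)) : ℕ) = 2 :=
    Nat.mod_eq_of_lt (show 2 < N + 2 by omega)
    omega
  have h3 : (3 : Fin (N + 2)) ≠ i := by
    rintro rfl
    have : ((3 : Fin (N + 2)) : ℕ) = 3 :=
    Nat.mod_eq_of_lt (show 3 < N + 2 by omega)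
    omega
  have hs : ∑ j : Fin (N + 2),
      (if 4 ≤ (j : ℕ) then (Pi.single i (1 : ℚ) : Fin (N + 2) → ℚ) j * c j else 0) = c i := by
    rw [Finset.sum_eq_single i]
    · simp [hi]
    · intro j _ hj
      simp [Pi.single_eq_of_ne hj]
    · simp
  simp [LamForm, hs, Pi.single_eq_of_ne h0, Pi.single_eq_of_ne h1, Pi.single_eq_of_ne h2,
    Pi.single_eq_of_ne h3]

/-- The `U`-coordinates as pairings. -/
lemma LamForm_singleU (N : ℕ) (hN : 4 ≤ N) (c : Fin (N + 2) → ℚ) :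
    LamForm N (Pi.single 1 1) c = c 0 ∧ LamForm N (Pi.single 0 1) c = c 1 ∧
    LamForm N (Pi.single 3 1) c = c 2 ∧ LamForm N (Pi.single 2 1) c = c 3 := by
  have v2 : ((2 : Fin (N + 2)) : ℕ) = 2 :=
    Nat.mod_eq_of_lt (show 2 < N + 2 by omega)
  have v3 : ((3 : Fin (N + 2)) : ℕ) = 3 :=
    Nat.mod_eq_of_lt (show 3 < N + 2 by omega)
  have v0 : ((0 : Fin (N + 2)) : ℕ) = 0 := rfl
  have v1 : ((1 : Fin (N + 2)) : ℕ) = 1 := by simp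
  have n01 : (0 : Fin (N + 2)) ≠ 1 := fun h => by rw [Fin.ext_iff] at h; omega
  have n02 : (0 : Fin (N + 2)) ≠ 2 := fun h => by rw [Fin.ext_iff] at h; omega
  have n03 : (0 : Fin (N + 2)) ≠ 3 := fun h => by rw [Fin.ext_iff] at h; omega
  have n12 : (1 : Fin (N + 2)) ≠ 2 := fun h => by rw [Fin.ext_iff] at h; omega
  have n13 : (1 : Fin (N + 2)) ≠ 3 := fun h => by rw [Fin.ext_iff] at h; omega
  have n23 : (2 : Fin (N + 2)) ≠ 3 := fun h => by rw [Fin.ext_iff] at h; omega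
  have hs : ∀ i : Fin (N + 2), (i : ℕ) < 4 → ∑ j : Fin (N + 2),
      (if 4 ≤ (j : ℕ) then (Pi.single i (1 : ℚ) : Fin (N + 2) → ℚ) j * c j else 0) = 0 := by
    intro i hi
    refine Finset.sum_eq_zero fun j _ => ?_
    split_ifs with h
    · have : j ≠ i := by rintro rfl; omega
      simp [Pi.single_eq_of_ne this]
    · rfl
  refine ⟨?_, ?_, ?_, ?_⟩
  · simp only [LamForm]; rw [hs _ (by omega)]; simp [Pi.single_apply, n01, n02, n03, n12, n13, n23, n01.symm, n02.symm, n03.symm,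
      n12.symm, n13.symm, n23.symm]
  · simp only [LamForm]; rw [hs _ (by omega)]; simp [Pi.single_apply, n01, n02, n03, n12, n13, n23, n01.symm, n02.symm, n03.symm,
      n12.symm, n13.symm, n23.symm]
  · simp only [LamForm]; rw [hs _ (by omega)]; simp [Pi.single_apply, n01, n02, n03, n12, n13, n23, n01.symm, n02.symm, n03.symm,
      n12.symm, n13.symm, n23.symm]
  · simp only [LamForm]; rw [hs _ (by omega)]; simp [Pi.single_apply, n01, n02, n03, n12, n13, n23, n01.symm, n02.symm, n03.symm,
      n12.symm, n13.symm, n23.symm]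

lemma single_int (n : ℕ) (i : Fin n) : IntVec (Pi.single i (1 : ℚ) : Fin n → ℚ) := by
  intro j
  by_cases h : j = i
  · subst h; exact ⟨1, by simp⟩
  · exact ⟨0, by simp [Pi.single_eq_of_ne h]⟩

lemma single_memU (N : ℕ) (i : Fin (N + 2)) (hi : (i : ℕ) < 4) :
    (Pi.single i (1 : ℚ) : Fin (N + 2) → ℚ) ∈ LamSet N := by
  refine ⟨single_int _ i, 0, ?_⟩
  simp only [Int.cast_zero, mul_zero]
  refine Finset.sum_eq_zero fun j _ => ?_
  split_ifs with h
  · have : j ≠ i := by rintro rfl; omega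
    simp [Pi.single_eq_of_ne this]
  · rfl

lemma single_not_mem (N : ℕ) (i : Fin (N + 2)) (hi : 4 ≤ (i : ℕ)) :
    (Pi.single i (1 : ℚ) : Fin (N + 2) → ℚ) ∉ LamSet N := by
  rintro ⟨-, a, ha⟩
  rw [Finset.sum_eq_single i] at ha
  · simp [hi] at ha
    have : (1 : ℤ) = 2 * a := by exact_mod_cast ha
    omega
  · intro j _ hj
    simp [Pi.single_eq_of_ne hj]
  · simp

/-- Roots of divisibility two. -/
def Root2 (N : ℕ) (c : Fin (N + 2) → ℚ) : Prop :=
  c ∈ LamSet N ∧ LamForm N c c = -2 ∧ ∀ y ∈ LamSet N, ∃ n : ℤ, LamForm N y c = 2 * n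

lemma card_ge4 (N : ℕ) (hN : 4 ≤ N) :
    ∑ i : Fin (N + 2), (if 4 ≤ (i : ℕ) then (1 : ℚ) else 0) = (N : ℚ) - 2 := by
  obtain ⟨m, rfl⟩ : ∃ m, N = m + 2 := ⟨N - 2, by omega⟩
  rw [Fin.sum_univ_eq_sum_range (fun i : ℕ => if 4 ≤ i then (1 : ℚ) else 0) (m + 2 + 2),
    show m + 2 + 2 = 4 + m by ring, Finset.sum_range_add]
  have h1 : ∑ i ∈ Finset.range 4, (if 4 ≤ i then (1 : ℚ) else 0) = 0 := by
    refine Finset.sum_eq_zero fun i hi => if_neg ?_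
    have := Finset.mem_range.1 hi
    omega
  have h2 : ∑ i ∈ Finset.range m, (if 4 ≤ 4 + i then (1 : ℚ) else 0) = m := by
    rw [Finset.sum_congr rfl fun i _ => if_pos (Nat.le_add_right 4 i)]
    simp
  rw [h1, h2]
  push_cast
  ring

lemma root_coords (N : ℕ) (hN : 4 ≤ N) {c : Fin (N + 2) → ℚ} (hc : Root2 N c) :
    N % 8 = 4 ∧ (∀ i : Fin (N + 2), 4 ≤ (i : ℕ) → ∃ n : ℤ, c i = 2 * n + 1) ∧
      ((∃ n : ℤ, c 0 = 2 * n) ∧ (∃ n : ℤ, c 1 = 2 * n) ∧ (∃ n : ℤ, c 2 = 2 * n) ∧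
        ∃ n : ℤ, c 3 = 2 * n) := by
  obtain ⟨hcL, hc2, hcd⟩ := hc
  have v2 : ((2 : Fin (N + 2)) : ℕ) = 2 :=
    Nat.mod_eq_of_lt (show 2 < N + 2 by omega)
  have v3 : ((3 : Fin (N + 2)) : ℕ) = 3 :=
    Nat.mod_eq_of_lt (show 3 < N + 2 by omega)
  have v0 : ((0 : Fin (N + 2)) : ℕ) = 0 := rfl
  have v1 : ((1 : Fin (N + 2)) : ℕ) = 1 := by simp
  obtain ⟨u0, u1, u2, u3⟩ := LamForm_singleU N hN c
  have k0 : ∃ n : ℤ, c 0 = 2 * n := by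
    rw [← u0]; exact hcd _ (single_memU N 1 (by omega))
  have k1 : ∃ n : ℤ, c 1 = 2 * n := by
    rw [← u1]; exact hcd _ (single_memU N 0 (by omega))
  have k2 : ∃ n : ℤ, c 2 = 2 * n := by
    rw [← u2]; exact hcd _ (single_memU N 3 (by omega))
  have k3 : ∃ n : ℤ, c 3 = 2 * n := by
    rw [← u3]; exact hcd _ (single_memU N 2 (by omega))
  obtain ⟨n0, h0⟩ := k0
  obtain ⟨n1, h1⟩ := k1
  obtain ⟨n2, h2⟩ := k2
  obtain ⟨n3, h3⟩ := k3
  have hpair : ∀ i j : Fin (N + 2), 4 ≤ (i : ℕ) → 4 ≤ (j : ℕ) → ∃ n : ℤ, c i + c j = 2 * n := by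
    intro i j hi hj
    obtain ⟨n, hn⟩ := hcd _ (add_mem_of_not_mem N (single_int _ i) (single_int _ j)
      (single_not_mem N i hi) (single_not_mem N j hj))
    rw [← LamB_apply, map_add, LinearMap.add_apply, LamB_apply, LamB_apply,
      LamForm_single N hN i hi, LamForm_single N hN j hj] at hn
    exact ⟨-n, by push_cast; linarith⟩
  have hodd : ∀ i : Fin (N + 2), 4 ≤ (i : ℕ) → ∃ n : ℤ, c i = 2 * n + 1 := by
    intro i hi
    obtain ⟨n, hn⟩ := hcL.1 i
    rcases Int.even_or_odd' n with ⟨m, rfl | rfl⟩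
    · exfalso
      obtain ⟨q, hq⟩ : ∃ q : ℤ,
          ∑ j : Fin (N + 2), (if 4 ≤ (j : ℕ) then c j * c j else 0) / 4 = q := by
        refine isInt_sum _ fun j _ => ?_
        split_ifs with hj
        · obtain ⟨r, hr⟩ := hpair i j hi hj
          refine ⟨(r - m) * (r - m), ?_⟩
          have : c j = 2 * (r - m) := by push_cast at hn; linarith
          rw [this]; push_cast; ring
        · exact ⟨0, by simp⟩
      rw [← Finset.sum_div] at hq
      simp only [LamForm, h0, h1, h2, h3] at hc2
      have : ((8 * (n0 * n1 + n2 * n3) - 4 * q : ℤ) : ℚ) = ((-2 : ℤ) : ℚ) := by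
        push_cast; linarith
      have : 8 * (n0 * n1 + n2 * n3) - 4 * q = -2 := by exact_mod_cast this
      omega
    · exact ⟨m, by rw [hn]; push_cast; ring⟩
  refine ⟨?_, hodd, ⟨n0, h0⟩, ⟨n1, h1⟩, ⟨n2, h2⟩, n3, h3⟩
  obtain ⟨q, hq⟩ : ∃ q : ℤ,
      ∑ j : Fin (N + 2), (if 4 ≤ (j : ℕ) then c j * c j - 1 else 0) / 8 = q := by
    refine isInt_sum _ fun j _ => ?_
    split_ifs with hj
    · obtain ⟨r, hr⟩ := hodd j hj
      obtain ⟨t, ht⟩ := Int.even_mul_succ_self r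
      refine ⟨t, ?_⟩
      have ht' : (r : ℚ) * (r + 1) = t + t := by exact_mod_cast ht
      rw [hr]
      linarith
    · exact ⟨0, by simp⟩
  rw [← Finset.sum_div] at hq
  have hsplit : ∑ j : Fin (N + 2), (if 4 ≤ (j : ℕ) then c j * c j - 1 else 0)
      = ∑ j : Fin (N + 2), (if 4 ≤ (j : ℕ) then c j * c j else 0) - (N - 2) := by
    rw [← card_ge4 N hN, ← Finset.sum_sub_distrib]
    refine Finset.sum_congr rfl fun i _ => ?_
    split_ifs <;> simp
  simp only [LamForm, h0, h1, h2, h3] at hc2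
  have : ((8 * (n0 * n1 + n2 * n3) - 8 * q - (N - 2) : ℤ) : ℚ) = ((-2 : ℤ) : ℚ) := by
    push_cast; linarith
  have : 8 * (n0 * n1 + n2 * n3) - 8 * q - ((N : ℤ) - 2) = -2 := by exact_mod_cast this
  omega

lemma half_diff_int (N : ℕ) (hN : 4 ≤ N) {c d : Fin (N + 2) → ℚ} (hc : Root2 N c)
    (hd : Root2 N d) : IntVec ((1 / 2 : ℚ) • (c - d)) := by
  obtain ⟨-, c1, c2, c3, c4, c5⟩ := root_coords N hN hc
  obtain ⟨-, d1, d2, d3, d4, d5⟩ := root_coords N hN hd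
  have hev : ∀ i, (∃ n : ℤ, c i = 2 * n) → (∃ n : ℤ, d i = 2 * n) →
      ∃ n : ℤ, ((1 / 2 : ℚ) • (c - d)) i = n := by
    rintro i ⟨n, hn⟩ ⟨m, hm⟩
    exact ⟨n - m, by simp [hn, hm]; ring⟩
  intro i
  by_cases hi : 4 ≤ (i : ℕ)
  · obtain ⟨n, hn⟩ := c1 i hi
    obtain ⟨m, hm⟩ := d1 i hi
    exact ⟨n - m, by simp [hn, hm]; ring⟩
  · have v2 : ((2 : Fin (N + 2)) : ℕ) = 2 :=
    Nat.mod_eq_of_lt (show 2 < N + 2 by omega)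
    have v3 : ((3 : Fin (N + 2)) : ℕ) = 3 :=
    Nat.mod_eq_of_lt (show 3 < N + 2 by omega)
    have v1 : ((1 : Fin (N + 2)) : ℕ) = 1 := by simp
    have : i = 0 ∨ i = 1 ∨ i = 2 ∨ i = 3 := by
      simp only [Fin.ext_iff, v2, v3, v1, Fin.val_zero]; omega
    rcases this with rfl | rfl | rfl | rfl
    · exact hev _ c2 d2
    · exact hev _ c3 d3
    · exact hev _ c4 d4
    · exact hev _ c5 d5

lemma half_diff_norm (N : ℕ) {c d : Fin (N + 2) → ℚ} (hc : Root2 N c) (hd : Root2 N d)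
    (hcd : LamForm N c d = 0) : (1 / 2 : ℚ) • (c - d) ∉ LamSet N := by
  intro h
  obtain ⟨n, hn⟩ := (mem_Lam_iff N h.1).1 h
  have h1 : LamB N c c = -2 := hc.2.1
  have h2 : LamB N d d = -2 := hd.2.1
  have h3 : LamB N c d = 0 := hcd
  have h4 : LamB N d c = 0 := by rw [LamB_apply, LamForm_symm]; exact hcd
  rw [← LamB_apply] at hn
  simp [h1, h2, h3, h4] at hn
  have : ((-1 : ℤ) : ℚ) = ((2 * n : ℤ) : ℚ) := by push_cast; linarith
  have : (-1 : ℤ) = 2 * n := by exact_mod_cast this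
  omega

theorem two_roots (N : ℕ) (hN : 4 ≤ N) {a b c d e f e' f' : Fin (N + 2) → ℚ}
    (F : Frame (LamB N) (LamL N) e f e' f') (ha : Root2 N a) (hb : Root2 N b)
    (hc : Root2 N c) (hd : Root2 N d) (hab : LamForm N a b = 0) (hcd : LamForm N c d = 0)
    (hea : LamForm N e a = 0) (hfa : LamForm N f a = 0) (hea' : LamForm N e' a = 0)
    (hfa' : LamForm N f' a = 0) (heb : LamForm N e b = 0) (hfb : LamForm N f b = 0)
    (hca : (1 / 2 : ℚ) • (c - a) ∈ LamSet N) :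
    ∃ G : (Fin (N + 2) → ℚ) ≃ₗ[ℚ] (Fin (N + 2) → ℚ),
      (∀ y z, LamForm N (G y) (G z) = LamForm N y z) ∧
      ∀ y, (G y ∈ LamSet N ∧ LamForm N (G y) c = 0 ∧ LamForm N (G y) d = 0) ↔
        (y ∈ LamSet N ∧ LamForm N y a = 0 ∧ LamForm N y b = 0) := by
  have H := Lam_even N
  obtain ⟨g, ⟨hg1, hg2⟩, hgc⟩ := eichler H F (a := a) (r := c) ha.1 hc.1 ha.2.1 hc.2.1 hc.2.2
    hea hfa hca
  have hgL : ∀ y, g y ∈ LamSet N ↔ y ∈ LamSet N := hg2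
  have hgB : ∀ y z, LamForm N (g y) (g z) = LamForm N y z := hg1
  obtain ⟨δ, rfl⟩ : ∃ δ, g δ = d := ⟨g.symm d, by simp⟩
  have hδ : Root2 N δ := by
    refine ⟨(hgL _).1 hd.1, by rw [← hgB]; exact hd.2.1, fun y hy => ?_⟩
    rw [← hgB]
    exact hd.2.2 _ ((hgL y).2 hy)
  have haδ : LamForm N a δ = 0 := by rw [← hgB, hgc]; exact hcd
  have hmem : (1 / 2 : ℚ) • (δ - b) ∈ LamSet N := by
    by_contra hno
    have h1 := half_diff_int N hN hδ hb
    have h2 := half_diff_int N hN hb ha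
    have h3 := half_diff_norm N hb ha (by rw [LamForm_symm]; exact hab)
    have h4 := add_mem_of_not_mem N h1 h2 hno h3
    refine half_diff_norm N hδ ha (by rw [LamForm_symm]; exact haδ) ?_
    convert h4 using 1
    module
  -- second step inside the orthogonal complement of `a`
  let Λ2 : AddSubgroup (Fin (N + 2) → ℚ) := LamL N ⊓ (LinearMap.ker (LamB N a)).toAddSubgroup
  have hΛ2 : ∀ y, y ∈ Λ2 ↔ y ∈ LamSet N ∧ LamForm N a y = 0 := fun y => Iff.rfl
  have H2 : EvenLat (LamB N) Λ2 :=
    ⟨H.symm, fun x hx y hy => H.int x hx.1 y hy.1, fun x hx => H.even x hx.1⟩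
  have F2 : Frame (LamB N) Λ2 e f e' f' :=
    ⟨(hΛ2 _).2 ⟨F.he, by rw [LamForm_symm]; exact hea⟩,
      (hΛ2 _).2 ⟨F.hf, by rw [LamForm_symm]; exact hfa⟩,
      (hΛ2 _).2 ⟨F.he', by rw [LamForm_symm]; exact hea'⟩,
      (hΛ2 _).2 ⟨F.hf', by rw [LamForm_symm]; exact hfa'⟩,
      F.ee, F.ff, F.ee2, F.ff2, F.ef, F.ef2, F.c1, F.c2, F.c3, F.c4⟩
  have hmem2 : (1 / 2 : ℚ) • (δ - b) ∈ Λ2 := by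
    refine (hΛ2 _).2 ⟨hmem, ?_⟩
    have h1 : LamB N a b = 0 := hab
    have h2 : LamB N a δ = 0 := haδ
    rw [← LamB_apply]
    simp [h1, h2]
  obtain ⟨h, ⟨hh1, hh2⟩, hhb⟩ := eichler H2 F2 (a := b) (r := δ) ((hΛ2 _).2 ⟨hb.1, hab⟩)
    ((hΛ2 _).2 ⟨hδ.1, haδ⟩) hb.2.1 hδ.2.1 (fun y hy => hδ.2.2 y hy.1) heb hfb hmem2
  have hhB : ∀ y z, LamForm N (h y) (h z) = LamForm N y z := hh1
  refine ⟨h.trans g, fun y z => ?_, fun y => ?_⟩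
  · rw [LinearEquiv.trans_apply, LinearEquiv.trans_apply, hgB, hhB]
  · have hy := hh2 y
    rw [hΛ2, hΛ2] at hy
    rw [LinearEquiv.trans_apply, ← hgc, hgB, hgB, hgL, ← hhb, hhB, ← and_assoc, ← and_assoc,
      LamForm_symm N (h y) a, hy, LamForm_symm N a y]

end Lam

section Reindex

lemma sum_range_blocks (k : ℕ) (f : ℕ → ℚ) :
    ∑ i ∈ Finset.range (8 * k), f i
      = ∑ j ∈ Finset.range k, ∑ r ∈ Finset.range 8, f (8 * j + r) := by
  induction k with
  | zero => simp
  | succ k ih => rw [Finset.sum_range_succ, ← ih, mul_add, mul_one, Finset.sum_range_add]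

/-- Regrouping of coordinates. -/
def phi (k : ℕ) : (Fin (8 * k + 4 + 2) → ℚ) ≃ₗ[ℚ] AA k where
  toFun x := ((fun i => x ⟨i, by omega⟩, fun j r => x ⟨4 + (8 * j + r), by omega⟩),
    (x ⟨8 * k + 4, by omega⟩, x ⟨8 * k + 5, by omega⟩))
  invFun p i := if h : (i : ℕ) < 4 then p.1.1 ⟨i, h⟩ else
    if h' : (i : ℕ) < 8 * k + 4 then
      p.1.2 ⟨((i : ℕ) - 4) / 8, by omega⟩ ⟨((i : ℕ) - 4) % 8, by omega⟩
    else if (i : ℕ) = 8 * k + 4 then p.2.1 else p.2.2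
  left_inv := by
    intro x
    funext i
    by_cases h : (i : ℕ) < 4
    · simp [h]
    · by_cases h' : (i : ℕ) < 8 * k + 4
      · simp only [h, h', dif_neg, dif_pos, not_false_eq_true]
        congr 1
        apply Fin.ext
        simp only
        omega
      · by_cases h'' : (i : ℕ) = 8 * k + 4
        · simp only [h, h', dif_neg, not_false_eq_true, if_pos h'']
          congr 1
          exact Fin.ext h''.symm
        · simp only [h, h', dif_neg, not_false_eq_true, if_neg h'']
          congr 1
          apply Fin.ext
          simp only
          omega
  right_inv := by
    intro p
    refine Prod.ext (Prod.ext ?_ ?_) (Prod.ext ?_ ?_)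
    · funext i
      simp
    · funext j r
      have h1 : ¬ (4 + (8 * (j : ℕ) + r) < 4) := by omega
      have h2 : 4 + (8 * (j : ℕ) + r) < 8 * k + 4 := by omega
      simp only [h1, h2, dif_neg, dif_pos, not_false_eq_true]
      have e1 : (⟨(4 + (8 * (j : ℕ) + r) - 4) / 8, by omega⟩ : Fin k) = j :=
        Fin.ext (by simp only; omega)
      have e2 : (⟨(4 + (8 * (j : ℕ) + r) - 4) % 8, by omega⟩ : Fin 8) = r :=
        Fin.ext (by simp only; omega)
      rw [e1, e2]
    · have h1 : ¬ (8 * k + 4 < 4) := by omega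
      simp
    · have h1 : ¬ (8 * k + 5 < 4) := by omega
      simp
  map_add' := fun _ _ => rfl
  map_smul' := fun _ _ => rfl

lemma phi_form (k : ℕ) (x y : Fin (8 * k + 4 + 2) → ℚ) :
    AForm k (phi k x) (phi k y) = LamForm (8 * k + 4) x y := by
  let f : ℕ → ℚ := fun i => if h : i < 8 * k + 4 + 2 then x ⟨i, h⟩ * y ⟨i, h⟩ else 0
  have hf : ∀ i (h : i < 8 * k + 4 + 2), f i = x ⟨i, h⟩ * y ⟨i, h⟩ := fun i h => dif_pos h
  have hsum : ∑ i : Fin (8 * k + 4 + 2), (if 4 ≤ (i : ℕ) then x i * y i else 0)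
      = ∑ j : Fin k, ∑ r : Fin 8, f (4 + (8 * j + r)) + f (8 * k + 4) + f (8 * k + 5) := by
    have h1 : ∀ i : Fin (8 * k + 4 + 2), (if 4 ≤ (i : ℕ) then x i * y i else 0)
        = (fun n : ℕ => if 4 ≤ n then f n else 0) i := by
      intro i
      simp only [hf i i.2]
    rw [Finset.sum_congr rfl fun i _ => h1 i, Fin.sum_univ_eq_sum_range
      (fun n : ℕ => if 4 ≤ n then f n else 0) (8 * k + 4 + 2),
      show 8 * k + 4 + 2 = 4 + (8 * k + 2) by ring, Finset.sum_range_add]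
    have h2 : ∑ i ∈ Finset.range 4, (if 4 ≤ i then f i else 0) = 0 := by
      refine Finset.sum_eq_zero fun i hi => if_neg ?_
      have := Finset.mem_range.1 hi
      omega
    rw [h2, zero_add, Finset.sum_congr rfl fun i _ => if_pos (Nat.le_add_right 4 i),
      Finset.sum_range_succ, Finset.sum_range_succ, sum_range_blocks]
    rw [show 4 + 8 * k = 8 * k + 4 by ring, show 4 + (8 * k + 1) = 8 * k + 5 by ring]
    congr 2
    rw [← Fin.sum_univ_eq_sum_range (fun j => ∑ r ∈ Finset.range 8, f (4 + (8 * j + r)))]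
    refine Finset.sum_congr rfl fun j _ => ?_
    rw [← Fin.sum_univ_eq_sum_range (fun r => f (4 + (8 * (j : ℕ) + r)))]
  have e0 : (0 : Fin (8 * k + 4 + 2)) = ⟨0, by omega⟩ := rfl
  have e1 : (1 : Fin (8 * k + 4 + 2)) = ⟨1, by omega⟩ :=
    Fin.ext (Nat.mod_eq_of_lt (show 1 < 8 * k + 4 + 2 by omega))
  have e2 : (2 : Fin (8 * k + 4 + 2)) = ⟨2, by omega⟩ :=
    Fin.ext (Nat.mod_eq_of_lt (show 2 < 8 * k + 4 + 2 by omega))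
  have e3 : (3 : Fin (8 * k + 4 + 2)) = ⟨3, by omega⟩ :=
    Fin.ext (Nat.mod_eq_of_lt (show 3 < 8 * k + 4 + 2 by omega))
  have hb : ∑ j : Fin k, negE ((phi k x).1.2 j) ((phi k y).1.2 j)
      = - ∑ j : Fin k, ∑ r : Fin 8, f (4 + (8 * j + r)) := by
    rw [← Finset.sum_neg_distrib]
    refine Finset.sum_congr rfl fun j _ => ?_
    rw [negE]
    congr 1
    refine Finset.sum_congr rfl fun r _ => ?_
    rw [hf _ (by omega)]
    rfl
  have hU : UForm (phi k x).1.1 (phi k y).1.1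
      = x 0 * y 1 + x 1 * y 0 + x 2 * y 3 + x 3 * y 2 := by
    rw [e0, e1, e2, e3]; rfl
  have hs : (phi k x).2.1 * (phi k y).2.1 = f (8 * k + 4) := by rw [hf _ (by omega)]; rfl
  have ht : (phi k x).2.2 * (phi k y).2.2 = f (8 * k + 5) := by rw [hf _ (by omega)]; rfl
  rw [AForm, IIForm, hb, hU, hs, ht, LamForm, hsum]
  ring

lemma phi_mem (k : ℕ) (x : Fin (8 * k + 4 + 2) → ℚ) :
    phi k x ∈ LS (∅ : Finset (Fin k)) ↔ IntVec x := by
  constructor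
  · rintro ⟨hu, hm, hs, ht⟩ i
    by_cases h : (i : ℕ) < 4
    · exact hu ⟨i, h⟩
    · by_cases h' : (i : ℕ) < 8 * k + 4
      · have := hm ⟨((i : ℕ) - 4) / 8, by omega⟩
        rw [if_neg (by simp)] at this
        have := this ⟨((i : ℕ) - 4) % 8, by omega⟩
        have e : i = ⟨4 + (8 * (((i : ℕ) - 4) / 8) + ((i : ℕ) - 4) % 8), by omega⟩ := by
          apply Fin.ext
          simp only
          omega
        rw [e]
        exact this
      · by_cases h'' : (i : ℕ) = 8 * k + 4
        · have e : i = ⟨8 * k + 4, by omega⟩ := Fin.ext h''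
          rw [e]; exact hs
        · have e : i = ⟨8 * k + 5, by omega⟩ := by
            apply Fin.ext
            simp only
            omega
          rw [e]; exact ht
  · intro h
    refine ⟨fun i => h _, fun j => ?_, h _, h _⟩
    rw [if_neg (by simp)]
    exact fun r => h _

lemma exists_model (k : ℕ) : ∃ Ψ : AA k ≃ₗ[ℚ] (Fin (8 * k + 4 + 2) → ℚ),
    (∀ p q, LamForm (8 * k + 4) (Ψ p) (Ψ q) = AForm k p q) ∧
    ∀ p, IntVec (Ψ p) ↔ p.1 ∈ IISet k ∧ (∃ a : ℤ, p.2.1 = a) ∧ ∃ b : ℤ, p.2.2 = b := by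
  obtain ⟨T, h1, h2⟩ := exists_block (Finset.univ : Finset (Fin k))
  refine ⟨T.trans (phi k).symm, fun p q => ?_, fun p => ?_⟩
  · rw [← phi_form]
    simp [h1]
  · rw [← phi_mem]
    simp only [LinearEquiv.trans_apply, LinearEquiv.apply_symm_apply]
    rw [h2]
    simp [LS, IISet, and_assoc]

lemma E8_even {x : Fin 8 → ℚ} (hx : x ∈ E8Set) : ∃ n : ℤ, negE x x = 2 * n := by
  obtain ⟨h | h, a, ha⟩ := hx
  · obtain ⟨m, hm⟩ := isEven_sum Finset.univ (f := fun i => x i * x i - x i)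
      fun i _ => sq_sub_even (h i)
    rw [Finset.sum_sub_distrib, ha] at hm
    exact ⟨-(m + a), by rw [negE]; push_cast; linarith⟩
  · obtain ⟨m, hm⟩ := isEven_sum Finset.univ
      (f := fun i => (x - halfVec 8) i * (x - halfVec 8) i - (x - halfVec 8) i)
      fun i _ => sq_sub_even (h i)
    have : ∀ i, (x - halfVec 8) i * (x - halfVec 8) i - (x - halfVec 8) i
        = x i * x i - 2 * x i + 3 / 4 := by
      intro i; simp only [Pi.sub_apply, halfVec]; ring
    simp only [this, Finset.sum_add_distrib, Finset.sum_sub_distrib, ← Finset.mul_sum, ha] at hm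
    simp at hm
    exact ⟨-(m + 2 * a - 3), by rw [negE]; push_cast; linarith⟩

lemma II_even {k : ℕ} {p : IIAmb k} (hp : p ∈ IISet k) : ∃ n : ℤ, IIForm k p p = 2 * n := by
  obtain ⟨n, hn⟩ := isInt_add (isInt_mul (hp.1 0) (hp.1 1)) (isInt_mul (hp.1 2) (hp.1 3))
  obtain ⟨m, hm⟩ := isEven_sum Finset.univ (f := fun j => negE (p.2 j) (p.2 j))
    fun j _ => E8_even (hp.2 j)
  exact ⟨n + m, by rw [IIForm, hm, UForm]; push_cast; linarith⟩

lemma IIForm_zero_right (k : ℕ) (p : IIAmb k) : IIForm k p 0 = 0 := by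
  simp [IIForm, UForm, negE]

lemma zero_mem_II (k : ℕ) : (0 : IIAmb k) ∈ IISet k := by
  refine ⟨fun i => ⟨0, by simp⟩, fun j => ⟨Or.inl fun i => ⟨0, by simp⟩, 0, by simp⟩⟩

lemma U_mem_II (k : ℕ) {u : Fin 4 → ℚ} (hu : IntVec u) : ((u, 0) : IIAmb k) ∈ IISet k :=
  ⟨hu, (zero_mem_II k).2⟩

theorem case_two (k : ℕ) {c d : Fin (8 * k + 4 + 2) → ℚ} (hc : Root2 (8 * k + 4) c)
    (hd : Root2 (8 * k + 4) d) (hcd : LamForm (8 * k + 4) c d = 0) :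
    ∃ F : IIAmb k →ₗ[ℚ] (Fin (8 * k + 4 + 2) → ℚ),
      Function.Injective F ∧
      (∀ x y, LamForm (8 * k + 4) (F x) (F y) = IIForm k x y) ∧
      F '' IISet k = {x | x ∈ LamSet (8 * k + 4) ∧ LamForm (8 * k + 4) x c = 0 ∧
        LamForm (8 * k + 4) x d = 0} := by
  have hN : 4 ≤ 8 * k + 4 := by omega
  obtain ⟨Ψ, hB, hI⟩ := exists_model k
  have hmem : ∀ p : AA k, p.1 ∈ IISet k → (∃ s t : ℤ, p.2 = (((s : ℤ) : ℚ), ((t : ℤ) : ℚ)) ∧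
      Even (s + t)) → Ψ p ∈ LamSet (8 * k + 4) := by
    rintro ⟨p, q⟩ hp ⟨s, t, rfl, r, hr⟩
    rw [mem_Lam_iff _ ((hI _).2 ⟨hp, ⟨s, rfl⟩, t, rfl⟩), hB]
    obtain ⟨n, hn⟩ := II_even hp
    refine ⟨n - (2 * r * r - 2 * r * t + t * t), ?_⟩
    have : s = r + r - t := by omega
    subst this
    simp only [AForm, hn]
    push_cast
    ring
  have hroot : ∀ σ : ℤ, σ = 1 ∨ σ = -1 →
      Root2 (8 * k + 4) (Ψ (0, ((1 : ℚ), (σ : ℚ)))) := by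
    intro σ hσ
    have hσ2 : (σ : ℚ) * σ = 1 := by rcases hσ with rfl | rfl <;> norm_num
    refine ⟨hmem _ (zero_mem_II k) ⟨1, σ, by simp, ?_⟩, ?_, fun y hy => ?_⟩
    · rcases hσ with rfl | rfl
      · exact ⟨1, by norm_num⟩
      · exact ⟨0, by norm_num⟩
    · rw [hB]
      simp only [AForm, IIForm_zero_right, hσ2]
      norm_num
    · obtain ⟨⟨p, s, t⟩, rfl⟩ := Ψ.surjective y
      obtain ⟨hp, ⟨s', hs⟩, t', ht⟩ := (hI _).1 hy.1
      simp only at hp hs ht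
      subst hs ht
      obtain ⟨m, hm⟩ := (mem_Lam_iff _ hy.1).1 hy
      obtain ⟨n, hn⟩ := II_even hp
      obtain ⟨q1, hq1⟩ := sq_sub_even ⟨s', rfl⟩
      obtain ⟨q2, hq2⟩ := sq_sub_even ⟨t', rfl⟩
      rw [hB] at hm ⊢
      simp only [AForm, IIForm_zero_right, hn] at hm ⊢
      rcases hσ with rfl | rfl
      · exact ⟨m - n + q1 + q2, by push_cast; linarith⟩
      · exact ⟨m - n + q1 + q2 + t', by push_cast; linarith⟩
  have ha := hroot 1 (Or.inl rfl)
  have hb := hroot (-1) (Or.inr rfl)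
  set a := Ψ (0, ((1 : ℚ), ((1 : ℤ) : ℚ))) with hadef
  set b := Ψ (0, ((1 : ℚ), ((-1 : ℤ) : ℚ))) with hbdef
  have hab : LamForm (8 * k + 4) a b = 0 := by
    rw [hadef, hbdef, hB]
    simp [AForm, IIForm_zero_right]
  have hUint : ∀ i : Fin 4, IntVec (Pi.single i (1 : ℚ) : Fin 4 → ℚ) := single_int 4
  let fr : Fin 4 → (Fin (8 * k + 4 + 2) → ℚ) := fun i => Ψ ((Pi.single i 1, 0), 0)
  have hfrmem : ∀ i, fr i ∈ LamL (8 * k + 4) := fun i =>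
    hmem _ (U_mem_II k (hUint i)) ⟨0, 0, by simp; rfl, by simp⟩
  have hfrB : ∀ i j, LamB (8 * k + 4) (fr i) (fr j)
      = UForm (Pi.single i 1) (Pi.single j 1) := by
    intro i j
    rw [LamB_apply, hB]
    simp [AForm, IIForm, negE]
  have hfrp : ∀ i (q : ℚ × ℚ), LamForm (8 * k + 4) (fr i) (Ψ (0, q)) = 0 := by
    intro i q
    rw [hB]
    simp [AForm, IIForm_zero_right]
  have Fr : Frame (LamB (8 * k + 4)) (LamL (8 * k + 4)) (fr 0) (fr 1) (fr 2) (fr 3) := by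
    refine ⟨hfrmem 0, hfrmem 1, hfrmem 2, hfrmem 3, ?_, ?_, ?_, ?_, ?_, ?_, ?_, ?_, ?_, ?_⟩ <;>
    · rw [hfrB]
      simp [UForm, Pi.single_apply]
  -- the orthogonal complement of the standard roots
  have hK : ∀ y, (y ∈ LamSet (8 * k + 4) ∧ LamForm (8 * k + 4) y a = 0 ∧
      LamForm (8 * k + 4) y b = 0) ↔ ∃ p ∈ IISet k, Ψ (p, 0) = y := by
    intro y
    constructor
    · rintro ⟨hy, h1, h2⟩
      obtain ⟨⟨p, s, t⟩, rfl⟩ := Ψ.surjective y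
      obtain ⟨hp, -, -⟩ := (hI _).1 hy.1
      rw [hadef, hB] at h1
      rw [hbdef, hB] at h2
      simp only [AForm, IIForm_zero_right] at h1 h2
      push_cast at h1 h2
      have hs : s = 0 := by linarith
      have ht : t = 0 := by linarith
      subst hs ht
      exact ⟨p, hp, rfl⟩
    · rintro ⟨p, hp, rfl⟩
      refine ⟨hmem _ hp ⟨0, 0, by simp; rfl, by simp⟩, ?_, ?_⟩
      · rw [hadef, hB]
        simp [AForm, IIForm_zero_right]
      · rw [hbdef, hB]
        simp [AForm, IIForm_zero_right]
  have hG : ∃ G : (Fin (8 * k + 4 + 2) → ℚ) ≃ₗ[ℚ] (Fin (8 * k + 4 + 2) → ℚ),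
      (∀ y z, LamForm (8 * k + 4) (G y) (G z) = LamForm (8 * k + 4) y z) ∧
      ∀ y, (G y ∈ LamSet (8 * k + 4) ∧ LamForm (8 * k + 4) (G y) c = 0 ∧
        LamForm (8 * k + 4) (G y) d = 0) ↔ ∃ p ∈ IISet k, Ψ (p, 0) = y := by
    by_cases hca : (1 / 2 : ℚ) • (c - a) ∈ LamSet (8 * k + 4)
    · obtain ⟨G, hG1, hG2⟩ := two_roots _ hN Fr ha hb hc hd hab hcd (hfrp 0 _) (hfrp 1 _)
        (hfrp 2 _) (hfrp 3 _) (hfrp 0 _) (hfrp 1 _) hca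
      exact ⟨G, hG1, fun y => by rw [hG2, hK]⟩
    · have hba : LamForm (8 * k + 4) b a = 0 := by rw [LamForm_symm]; exact hab
      have hcb : (1 / 2 : ℚ) • (c - b) ∈ LamSet (8 * k + 4) := by
        have := add_mem_of_not_mem _ (half_diff_int _ hN hc ha) (half_diff_int _ hN ha hb)
          hca (half_diff_norm _ ha hb hab)
        convert this using 1
        module
      obtain ⟨G, hG1, hG2⟩ := two_roots _ hN Fr hb ha hc hd hba hcd (hfrp 0 _) (hfrp 1 _)
        (hfrp 2 _) (hfrp 3 _) (hfrp 0 _) (hfrp 1 _) hcb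
      refine ⟨G, hG1, fun y => ?_⟩
      rw [hG2, ← hK]
      tauto
  obtain ⟨G, hG1, hG2⟩ := hG
  refine ⟨(G.toLinearMap ∘ₗ Ψ.toLinearMap) ∘ₗ LinearMap.inl ℚ (IIAmb k) (ℚ × ℚ), ?_, ?_, ?_⟩
  · intro x y hxy
    simpa using hxy
  · intro x y
    simp [hG1, hB, AForm]
  · ext y
    constructor
    · rintro ⟨p, hp, rfl⟩
      exact (hG2 (Ψ (p, 0))).2 ⟨p, hp, rfl⟩
    · intro hy
      obtain ⟨z, rfl⟩ := G.surjective y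
      obtain ⟨p, hp, rfl⟩ := (hG2 z).1 hy
      exact ⟨p, hp, rfl⟩

end Reindex

/-- Let `(Λ_N, ξ)` be a decorated `D`-lattice of dimension `N ≥ 4`, `v` a hyperelliptic
vector, and `η = [w₀/2]` the induced decoration of `v^⊥` (where `w₀ ∈ v^⊥` satisfies
`(v + w₀)/2 ∈ Λ`).  If `w ∈ v^⊥` is a hyperelliptic vector of `Λ` orthogonal to `v`,
then either (1) `w` has divisibility `2` in `v^⊥` and is a hyperelliptic vector of
`(v^⊥, η)`, or (2) `w` has divisibility `4` in `v^⊥`, `{v,w}^⊥ ≅ II_{2,N-2}`, and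
`N ≡ 4 (mod 8)`. -/
theorem statement15 (N : ℕ) (hN : 4 ≤ N)
    (v : Fin (N + 2) → ℚ) (hvL : v ∈ LamSet N)
    (hv2 : LamForm N v v = -4) (hvdiv : HasDiv N v 2)
    (w₀ : Fin (N + 2) → ℚ) (hw₀L : w₀ ∈ LamSet N) (hw₀p : LamForm N w₀ v = 0)
    (hglue : (1/2 : ℚ) • (v + w₀) ∈ LamSet N)
    (w : Fin (N + 2) → ℚ) (hwL : w ∈ LamSet N) (hwperp : LamForm N w v = 0)
    (hw2 : LamForm N w w = -4) (hwdiv : HasDiv N w 2)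
    (hwclass : (1/2 : ℚ) • (w - v) ∈ LamSet N) :
    ((∀ x, x ∈ LamSet N → LamForm N x v = 0 → ∃ a : ℤ, LamForm N w x = 2 * (a : ℚ)) ∧
      (∃ x, x ∈ LamSet N ∧ LamForm N x v = 0 ∧ LamForm N w x = 2) ∧
      (1/2 : ℚ) • (w - w₀) ∈ LamSet N) ∨
    ((∀ x, x ∈ LamSet N → LamForm N x v = 0 → ∃ a : ℤ, LamForm N w x = 4 * (a : ℚ)) ∧
      (∃ x, x ∈ LamSet N ∧ LamForm N x v = 0 ∧ LamForm N w x = 4) ∧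
      N % 8 = 4 ∧
      ∃ F : IIAmb ((N - 4) / 8) →ₗ[ℚ] (Fin (N + 2) → ℚ),
        Function.Injective F ∧
        (∀ x y, LamForm N (F x) (F y) = IIForm ((N - 4) / 8) x y) ∧
        F '' IISet ((N - 4) / 8) =
          {x | x ∈ LamSet N ∧ LamForm N x v = 0 ∧ LamForm N x w = 0}) := by
  have hv2' : LamB N v v = -4 := hv2
  have hw2' : LamB N w w = -4 := hw2
  have hwv : LamB N w v = 0 := hwperp
  have hvw : LamB N v w = 0 := by rw [LamB_apply, LamForm_symm]; exact hwperp
  by_cases hcase : ∃ x, x ∈ LamSet N ∧ LamForm N x v = 0 ∧ ∃ m : ℤ, LamForm N w x = 4 * m + 2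
  · left
    refine ⟨fun x hx _ => ?_, ?_, ?_⟩
    · obtain ⟨a, ha⟩ := hwdiv.1 x hx
      exact ⟨a, by rw [ha]; norm_num⟩
    · obtain ⟨x, hx, hxv, m, hm⟩ := hcase
      refine ⟨x + (m : ℚ) • w, (LamL N).add_mem hx (zsmul_mem_rat (LamL N) hwL rfl), ?_, ?_⟩
      · have h1 : LamB N x v = 0 := hxv
        rw [← LamB_apply]
        simp [h1, hwv]
      · have h1 : LamB N w x = 4 * m + 2 := hm
        rw [← LamB_apply]
        simp [h1, hw2']
        ring
    · have h1 := (LamL N).sub_mem ((LamL N).add_mem hwclass hvL) hglue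
      rw [mem_LamL] at h1
      convert h1 using 1
      module
  · right
    have h4 : ∀ x, x ∈ LamSet N → LamForm N x v = 0 → ∃ a : ℤ, LamForm N w x = 4 * (a : ℚ) := by
      intro x hx hxv
      obtain ⟨a, ha⟩ := hwdiv.1 x hx
      rcases Int.even_or_odd' a with ⟨m, rfl | rfl⟩
      · exact ⟨m, by rw [ha]; push_cast; ring⟩
      · exact absurd ⟨x, hx, hxv, m, by rw [ha]; push_cast; ring⟩ hcase
    have hdL : (1 / 2 : ℚ) • (w - v) ∈ LamL N := hwclass
    have hcL : (1 / 2 : ℚ) • (w + v) ∈ LamL N := by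
      have := (LamL N).add_mem hdL hvL
      convert this using 1
      module
    -- pairings with `w + v` are divisible by four
    have key : ∀ y ∈ LamSet N, ∃ n : ℤ, LamB N y w + LamB N y v = 4 * n := by
      intro y hy
      obtain ⟨p, hp⟩ := hvdiv.1 y hy
      have hp' : LamB N y v = 2 * p := by
        rw [LamB_apply, LamForm_symm, hp]; norm_num
      have hz : y - (p : ℚ) • ((1 / 2 : ℚ) • (w - v)) ∈ LamL N :=
        (LamL N).sub_mem hy (zsmul_mem_rat (LamL N) hdL rfl)
      obtain ⟨a, ha⟩ := h4 (y - (p : ℚ) • ((1 / 2 : ℚ) • (w - v))) hz (by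
        rw [← LamB_apply]
        simp [hp', hwv, hv2']
        ring)
      rw [LamForm_symm, ← LamB_apply] at ha
      simp [hw2', hvw] at ha
      exact ⟨a, by rw [← ha, hp']; ring⟩
    have hc : Root2 N ((1 / 2 : ℚ) • (w + v)) := by
      refine ⟨hcL, ?_, fun y hy => ?_⟩
      · rw [← LamB_apply]
        simp [hw2', hv2', hwv, hvw]
        norm_num
      · obtain ⟨n, hn⟩ := key y hy
        refine ⟨n, ?_⟩
        rw [← LamB_apply]
        simp only [map_smul, map_add, smul_eq_mul, hn]
        ring
    have hd : Root2 N ((1 / 2 : ℚ) • (w - v)) := by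
      refine ⟨hdL, ?_, fun y hy => ?_⟩
      · rw [← LamB_apply]
        simp [hw2', hv2', hwv, hvw]
        norm_num
      · obtain ⟨n, hn⟩ := key y hy
        obtain ⟨p, hp⟩ := hvdiv.1 y hy
        have hp' : LamB N y v = 2 * p := by
          rw [LamB_apply, LamForm_symm, hp]; norm_num
        refine ⟨n - p, ?_⟩
        rw [← LamB_apply]
        simp only [map_smul, map_sub, smul_eq_mul]
        push_cast
        linarith
    have hcd : LamForm N ((1 / 2 : ℚ) • (w + v)) ((1 / 2 : ℚ) • (w - v)) = 0 := by
      rw [← LamB_apply]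
      simp [hw2', hv2', hwv, hvw]
    have hN8 := (root_coords N hN hc).1
    refine ⟨h4, ⟨-w, (LamL N).neg_mem hwL, ?_, ?_⟩, hN8, ?_⟩
    · rw [← LamB_apply]
      simp [hwv]
    · rw [← LamB_apply]
      simp [hw2']
    · obtain ⟨k, rfl⟩ : ∃ k, N = 8 * k + 4 := ⟨N / 8, by omega⟩
      have hk : (8 * k + 4 - 4) / 8 = k := by omega
      rw [hk]
      obtain ⟨F, h1, h2, h3⟩ := case_two k hc hd hcd
      refine ⟨F, h1, h2, ?_⟩
      rw [h3]
      ext x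
      simp only [Set.mem_setOf_eq, ← LamB_apply, map_smul, map_add, map_sub, smul_eq_mul]
      constructor
      · rintro ⟨hx, e1, e2⟩
        exact ⟨hx, by linarith, by linarith⟩
      · rintro ⟨hx, e1, e2⟩
        exact ⟨hx, by rw [e1, e2]; norm_num, by rw [e1, e2]; norm_num⟩
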